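/- Local statistics at a tripod point of the uniform spanning tree: as n → ∞, the proportion of trees T in A_n in which the vertex v_t(n) has degree exactly 4 in T converges to 4/π − 1; consequently, the average over T ∈ A_n of the degree of v_t(n) in T converges to 2 + 4/π. -/

import Mathlib

/-- The box `{-n,…,n} × {0,…,2n}` in `ℤ²`. -/
def Bbox (n : ℕ) : Set (ℤ × ℤ) :=
  {p | -(n : ℤ) ≤ p.1 ∧ p.1 ≤ (n : ℤ) ∧ 0 ≤ p.2 ∧ p.2 ≤ 2 * (n : ℤ)}

/-- The grid graph `B_n` on the box `{-n,…,n} × {0,…,2n}`, with two vertices adjacent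
when at Euclidean distance `1`. -/
def Bgraph (n : ℕ) : SimpleGraph (ℤ × ℤ) :=
  SimpleGraph.fromRel (fun p q =>
    p ∈ Bbox n ∧ q ∈ Bbox n ∧ (p.1 - q.1) ^ 2 + (p.2 - q.2) ^ 2 = 1)

/-- The tripod point `v_t(n) = (⌊m·Re u⌋, ⌊m·Im u⌋)` where `m = ⌊√n⌋`. -/
noncomputable def tripodPt (u : ℂ) (n : ℕ) : ℤ × ℤ :=
  (⌊(Nat.sqrt n : ℝ) * u.re⌋, ⌊(Nat.sqrt n : ℝ) * u.im⌋)

/-- The boundary point `v_i(n) = (⌊m·z⌋, 0)` where `m = ⌊√n⌋`. -/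
noncomputable def bdryPt (z : ℝ) (n : ℕ) : ℤ × ℤ := (⌊(Nat.sqrt n : ℝ) * z⌋, 0)

/-- A subgraph `T` of `B_n` has a tripod at `a` to `b`, `c`, `d`: it contains three
paths, from `a` to `b`, `a` to `c`, and `a` to `d`, pairwise having only the vertex
`a` in common. -/
def HasTripod (n : ℕ) (T : (Bgraph n).Subgraph) (a b c d : ℤ × ℤ) : Prop :=
  ∃ (p₁ : T.spanningCoe.Walk a b) (p₂ : T.spanningCoe.Walk a c)
      (p₃ : T.spanningCoe.Walk a d),
    p₁.IsPath ∧ p₂.IsPath ∧ p₃.IsPath ∧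
    (∀ x, x ∈ p₁.support → x ∈ p₂.support → x = a) ∧
    (∀ x, x ∈ p₁.support → x ∈ p₃.support → x = a) ∧
    (∀ x, x ∈ p₂.support → x ∈ p₃.support → x = a)

/-- The set `A_n` of spanning trees of `B_n` having a tripod at `v_t(n)` to
`v₁(n), v₂(n), v₃(n)`. -/
def TripodTrees (z₁ z₂ z₃ : ℝ) (u : ℂ) (n : ℕ) : Set ((Bgraph n).Subgraph) :=
  {T | T.verts = Bbox n ∧ T.coe.IsTree ∧
    HasTripod n T (tripodPt u n) (bdryPt z₁ n) (bdryPt z₂ n) (bdryPt z₃ n)}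

section FominIdentity

variable {V : Type*}

/-- `Parent p y x` says that `y` is the parent of `x` under the partial map `p`. -/
def Parent (p : V → Option V) (y x : V) : Prop := p x = some y

/-- The parent function `p` has no cycles, i.e. it encodes a spanning forest
rooted at the outer vertex `none`. -/
abbrev Rooted (p : V → Option V) : Prop := WellFounded (Parent p)

theorem Rooted.exists_last {p : V → Option V} (h : Rooted p) :
    ∃ f : V → V, (∀ x, p x = none → f x = x) ∧ ∀ x y, p x = some y → f x = f y := by
  classical
  refine ⟨h.fix fun x F => if hx : ∃ y, p x = some y then F hx.choose hx.choose_spec else x,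
    ?_, ?_⟩
  · intro x hx
    rw [WellFounded.fix_eq, dif_neg]
    simp [hx]
  · intro x y hxy
    have hx : ∃ y, p x = some y := ⟨y, hxy⟩
    rw [WellFounded.fix_eq, dif_pos hx]
    exact congrArg _ (Option.some.inj (hx.choose_spec.symm.trans hxy))

open Classical in
/-- The last vertex before the root on the branch of `p` issued from `x`. -/
noncomputable def last (p : V → Option V) : V → V :=
  if h : Rooted p then h.exists_last.choose else id

theorem last_of_none {p : V → Option V} (h : Rooted p) {x : V} (hx : p x = none) :
    last p x = x := by
  rw [last, dif_pos h]
  exact h.exists_last.choose_spec.1 x hx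

theorem last_of_some {p : V → Option V} (h : Rooted p) {x y : V} (hx : p x = some y) :
    last p x = last p y := by
  rw [last, dif_pos h]
  exact h.exists_last.choose_spec.2 x y hx

theorem parent_last {p : V → Option V} (h : Rooted p) (x : V) : p (last p x) = none := by
  induction x using h.induction with
  | _ x ih =>
    cases hx : p x with
    | none => rw [last_of_none h hx, hx]
    | some y => rw [last_of_some h hx]; exact ih y hx

variable [DecidableEq V]

/-- The row vector of a vertex, with the root grounded. -/
def optRow (o : Option V) : V → ℝ := o.elim 0 fun y => Pi.single y 1

/-- The matrix with rows `e_x - e_{p x}`. -/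
def parentMatrix (p : V → Option V) : Matrix V V ℝ :=
  fun x => Pi.single x 1 - optRow (p x)

theorem parentMatrix_mulVec [Fintype V] (p : V → Option V) (g : V → ℝ) (x : V) :
    (parentMatrix p).mulVec g x = g x - (p x).elim 0 g := by
  rw [Matrix.mulVec, parentMatrix, sub_dotProduct]
  congr 1
  · simp
  · cases p x <;> simp [optRow]

theorem det_parentMatrix [Fintype V] {p : V → Option V} (h : Rooted p) : (parentMatrix p).det = 1 := by
  classical
  have : IsWellFounded V (Parent p) := ⟨h⟩
  have hz : ∀ x y, x ≠ y → IsWellFounded.rank (Parent p) x ≤ IsWellFounded.rank (Parent p) y →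
      parentMatrix p x y = 0 := by
    intro x y hxy hr
    have h2 : p x ≠ some y := fun hp =>
      absurd (IsWellFounded.rank_lt_of_rel (r := Parent p) (a := y) (b := x) hp) (not_lt.2 hr)
    cases hp : p x with
    | none => simp [parentMatrix, optRow, hp, hxy.symm]
    | some z =>
      have : y ≠ z := by rintro rfl; exact h2 hp
      simp [parentMatrix, optRow, hp, hxy.symm, this]
  have hd : ∀ x, parentMatrix p x x = 1 := by
    intro x
    cases hp : p x with
    | none => simp [parentMatrix, optRow, hp]
    | some z =>
      have : x ≠ z := by
        rintro rfl
        exact absurd (IsWellFounded.rank_lt_of_rel (r := Parent p) (a := x) (b := x) hp)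
          (lt_irrefl _)
      simp [parentMatrix, optRow, hp, this]
  have hb : (parentMatrix p).BlockTriangular
      (fun x => OrderDual.toDual (IsWellFounded.rank (Parent p) x)) := by
    intro x y hxy
    have hlt : IsWellFounded.rank (Parent p) x < IsWellFounded.rank (Parent p) y := hxy
    exact hz x y (by rintro rfl; exact lt_irrefl _ hlt) hlt.le
  rw [hb.det]
  refine Finset.prod_eq_one fun a _ => ?_
  have : (parentMatrix p).toSquareBlock
      (fun x => OrderDual.toDual (IsWellFounded.rank (Parent p) x)) a = 1 := by
    ext ⟨x, hx⟩ ⟨y, hy⟩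
    by_cases hxy : x = y
    · subst hxy
      simp [Matrix.toSquareBlock, Matrix.toSquareBlockProp, hd]
    · have : IsWellFounded.rank (Parent p) x ≤ IsWellFounded.rank (Parent p) y :=
        le_of_eq (OrderDual.toDual.injective (hx.trans hy.symm))
      simp [Matrix.toSquareBlock, Matrix.toSquareBlockProp, hxy, hz x y hxy this]
  rw [this, Matrix.det_one]

open Classical in
/-- The matrix obtained from `L` by replacing its row `a j` by the coordinate row of `x j`. -/
noncomputable def replaceRows {k : ℕ} (L : Matrix V V ℝ) (a x : Fin k → V) : Matrix V V ℝ :=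
  fun v => if h : ∃ j, a j = v then Pi.single (x h.choose) 1 else L v

theorem replaceRows_apply {k : ℕ} (L : Matrix V V ℝ) {a : Fin k → V}
    (ha : Function.Injective a) (x : Fin k → V) (j : Fin k) :
    replaceRows L a x (a j) = Pi.single (x j) 1 := by
  have h : ∃ i, a i = a j := ⟨j, rfl⟩
  rw [replaceRows, dif_pos h, ha h.choose_spec]

theorem replaceRows_of_notMem {k : ℕ} (L : Matrix V V ℝ) (a x : Fin k → V) {v : V}
    (h : ¬ ∃ j, a j = v) : replaceRows L a x v = L v := by
  rw [replaceRows, dif_neg h]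

theorem det_replaceRows [Fintype V] {k : ℕ} (L G : Matrix V V ℝ) (hG : L * G = 1) {a : Fin k → V}
    (ha : Function.Injective a) (x : Fin k → V) :
    (replaceRows L a x).det = L.det * (Matrix.of fun i j => G (x i) (a j)).det := by
  classical
  have hGL : G * L = 1 := mul_eq_one_comm.mp hG
  set M := replaceRows L a x
  have h1 : M.det = (M * G).det * L.det := by
    rw [← Matrix.det_mul, Matrix.mul_assoc, hGL, Matrix.mul_one]
  have hr1 : ∀ j, (M * G) (a j) = G (x j) := by
    intro j
    ext w
    rw [Matrix.mul_apply', show M (a j) = _ from replaceRows_apply L ha x j]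
    simp
  have hr2 : ∀ v, (¬ ∃ j, a j = v) → (M * G) v = (1 : Matrix V V ℝ) v := by
    intro v hv
    ext w
    rw [← hG, Matrix.mul_apply', Matrix.mul_apply',
      show M v = _ from replaceRows_of_notMem L a x hv]
  have h2 := Matrix.twoBlockTriangular_det (M * G) (fun v => ∃ j, a j = v) (by
    intro v hv w hw
    rw [hr2 v hv, Matrix.one_apply_ne]
    rintro rfl
    exact hv hw)
  have h3 : (Matrix.toSquareBlockProp (M * G) fun v => ¬ ∃ j, a j = v) = 1 := by
    ext ⟨v, hv⟩ ⟨w, hw⟩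
    change (M * G) v w = _
    simp only [hr2 v hv, Matrix.one_apply, Subtype.mk.injEq]
  let e : Fin k ≃ {v // ∃ j, a j = v} :=
    Equiv.ofBijective (fun j => ⟨a j, j, rfl⟩)
      ⟨fun i j h => ha (congrArg Subtype.val h), fun ⟨v, j, hj⟩ => ⟨j, Subtype.ext hj⟩⟩
  have h4 : (Matrix.toSquareBlockProp (M * G) fun v => ∃ j, a j = v).submatrix e e =
      Matrix.of fun i j => G (x i) (a j) := by
    ext i j
    simp only [Matrix.submatrix_apply, Matrix.toSquareBlockProp, Matrix.of_apply]
    exact congrFun (hr1 i) (a j)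
  rw [h1, h2, h3, Matrix.det_one, mul_one, ← h4, Matrix.det_submatrix_equiv_self, mul_comm]

theorem det_replaceRows_of_not_rooted [Fintype V] {k : ℕ} {p : V → Option V} (h : ¬ Rooted p)
    {a : Fin k → V} (hp : ∀ j, p (a j) = none) (x : Fin k → V) :
    (replaceRows (parentMatrix p) a x).det = 0 := by
  classical
  set M := replaceRows (parentMatrix p) a x
  have hstep : ∀ v, ¬ Acc (Parent p) v → ∃ w, p v = some w ∧ ¬ Acc (Parent p) w := by
    intro v hv
    by_contra hc
    push Not at hc
    exact hv (Acc.intro v fun w hw => hc w hw)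
  have hrow : ∀ v, ¬ Acc (Parent p) v → M v = parentMatrix p v := by
    intro v hv
    refine replaceRows_of_notMem _ a x ?_
    rintro ⟨j, rfl⟩
    obtain ⟨w, hw, -⟩ := hstep _ hv
    rw [hp] at hw
    cases hw
  have h2 := Matrix.twoBlockTriangular_det' M (fun v => ¬ Acc (Parent p) v) (by
    intro v hv w hw
    obtain ⟨z, hz, hz'⟩ := hstep v hv
    have h1 : w ≠ v := by rintro rfl; exact hw hv
    have h2 : w ≠ z := by rintro rfl; exact hw hz'
    rw [hrow v hv]
    simp [parentMatrix, hz, optRow, h1, h2])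
  rw [h2]
  have h3 : (Matrix.toSquareBlockProp M fun v => ¬ Acc (Parent p) v).det = 0 := by
    rw [← Matrix.exists_mulVec_eq_zero_iff]
    refine ⟨fun _ => 1, ?_, ?_⟩
    · obtain ⟨v, hv⟩ : ∃ v, ¬ Acc (Parent p) v := by
        by_contra hc
        push Not at hc
        exact h ⟨hc⟩
      intro h0
      exact one_ne_zero (congrFun h0 ⟨v, hv⟩)
    · ext ⟨v, hv⟩
      obtain ⟨z, hz, hz'⟩ := hstep v hv
      have he : ∀ w : {w // ¬ Acc (Parent p) w}, M v w =
          (if w = ⟨v, hv⟩ then 1 else 0) - (if w = ⟨z, hz'⟩ then 1 else 0) := by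
        rintro ⟨w, hw⟩
        rw [hrow v hv]
        simp [parentMatrix, hz, optRow, Pi.single_apply]
      change ∑ w : {w // ¬ Acc (Parent p) w}, M v w * 1 = 0
      simp [he]
  rw [h3, zero_mul]

/-- The Laplacian, grounded at the root, of the graph in which the neighbours of `x`
are the elements of `nb x`. -/
def groundedLaplacian (nb : V → Finset (Option V)) : Matrix V V ℝ :=
  fun x => ∑ o ∈ nb x, (Pi.single x 1 - optRow o)

theorem det_replaceRows_parentMatrix [Fintype V] {k : ℕ} {p : V → Option V} (h : Rooted p)
    {a : Fin k → V} (ha : Function.Injective a) (hp : ∀ j, p (a j) = none) (x : Fin k → V) :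
    (replaceRows (parentMatrix p) a x).det =
      (Matrix.of fun i j => if last p (x i) = a j then (1 : ℝ) else 0).det := by
  have hu : IsUnit (parentMatrix p).det := by rw [det_parentMatrix h]; exact isUnit_one
  rw [det_replaceRows _ _ (Matrix.mul_nonsing_inv _ hu) ha, det_parentMatrix h, one_mul]
  congr 1
  ext i j
  simp only [Matrix.of_apply]
  have hg : (parentMatrix p).mulVec (fun y => if last p y = a j then (1 : ℝ) else 0) =
      Pi.single (a j) 1 := by
    ext y
    rw [parentMatrix_mulVec]
    cases hy : p y with
    | none => simp [last_of_none h hy, Pi.single_apply]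
    | some z =>
      have : y ≠ a j := by
        rintro rfl
        rw [hp] at hy
        cases hy
      simp [last_of_some h hy, this]
  have h2 : (fun y => if last p y = a j then (1 : ℝ) else 0) =
      (parentMatrix p)⁻¹.mulVec (Pi.single (a j) 1) := by
    rw [← hg, Matrix.mulVec_mulVec, Matrix.nonsing_inv_mul _ hu, Matrix.one_mulVec]
  have h3 := congrFun h2 (x i)
  simp only [Matrix.mulVec_single_one, Matrix.col_apply] at h3
  exact h3.symm

open Classical in
/-- Fomin's identity: a signed count of spanning trees according to the last vertices of
given branches is a minor of the Green's function. -/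
theorem fomin_identity [Fintype V] {k : ℕ} (nb : V → Finset (Option V)) (G : Matrix V V ℝ)
    (hG : groundedLaplacian nb * G = 1) {a : Fin k → V} (ha : Function.Injective a)
    (hnb : ∀ j, none ∈ nb (a j)) (x : Fin k → V) :
    ∑ p : V → Option V with (∀ v, p v ∈ nb v) ∧ Rooted p ∧ ∀ j, p (a j) = none,
        (Matrix.of fun i j => if last p (x i) = a j then (1 : ℝ) else 0).det =
      (groundedLaplacian nb).det * (Matrix.of fun i j => G (x i) (a j)).det := by
  rw [← det_replaceRows _ _ hG ha]
  let nb' : V → Finset (Option V) := fun v => if ∃ j, a j = v then {none} else nb v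
  let row : V → Option V → V → ℝ := fun v o =>
    if h : ∃ j, a j = v then Pi.single (x h.choose) 1 else Pi.single v 1 - optRow o
  have h1 : replaceRows (groundedLaplacian nb) a x = fun v => ∑ o ∈ nb' v, row v o := by
    funext v
    by_cases h : ∃ j, a j = v
    · simp only [replaceRows, nb', row, dif_pos h, if_pos h, Finset.sum_singleton]
    · simp only [replaceRows, nb', row, dif_neg h, if_neg h, groundedLaplacian]
  have h2 : (replaceRows (groundedLaplacian nb) a x).det =
      ∑ p ∈ Fintype.piFinset nb', Matrix.det (fun v => row v (p v)) := by
    rw [h1]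
    exact (Matrix.detRowAlternating (R := ℝ) (n := V)).toMultilinearMap.map_sum_finset row nb'
  have h3 : ∀ p : V → Option V, (fun v => row v (p v)) = replaceRows (parentMatrix p) a x := by
    intro p
    funext v
    simp only [row, replaceRows, parentMatrix]
  have hnb1 : ∀ v, (∃ j, a j = v) → nb' v = {none} := fun v hv => if_pos hv
  have hnb2 : ∀ v, (¬ ∃ j, a j = v) → nb' v = nb v := fun v hv => if_neg hv
  have h4 : ∀ p : V → Option V, p ∈ Fintype.piFinset nb' ↔
      (∀ v, p v ∈ nb v) ∧ ∀ j, p (a j) = none := by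
    intro p
    rw [Fintype.mem_piFinset]
    constructor
    · intro h
      have hn : ∀ j, p (a j) = none := by
        intro j
        have := h (a j)
        rwa [hnb1 _ ⟨j, rfl⟩, Finset.mem_singleton] at this
      refine ⟨fun v => ?_, hn⟩
      by_cases hv : ∃ j, a j = v
      · obtain ⟨j, rfl⟩ := hv
        rw [hn j]
        exact hnb j
      · have := h v
        rwa [hnb2 _ hv] at this
    · rintro ⟨h, hn⟩ v
      by_cases hv : ∃ j, a j = v
      · obtain ⟨j, rfl⟩ := hv
        rw [hnb1 _ ⟨j, rfl⟩, hn j, Finset.mem_singleton]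
      · rw [hnb2 _ hv]
        exact h v
  rw [h2]
  refine Finset.sum_subset_zero_on_sdiff ?_ ?_ ?_
  · intro p hp
    simp only [Finset.mem_filter, Finset.mem_univ, true_and] at hp
    exact (h4 p).2 ⟨hp.1, hp.2.2⟩
  · intro p hp
    simp only [Finset.mem_sdiff, Finset.mem_filter, Finset.mem_univ, true_and, h4] at hp
    rw [h3]
    exact det_replaceRows_of_not_rooted (fun h => hp.2 ⟨hp.1.1, h, hp.1.2⟩) hp.1.2 x
  · intro p hp
    simp only [Finset.mem_filter, Finset.mem_univ, true_and] at hp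
    rw [h3, det_replaceRows_parentMatrix hp.2.1 ha hp.2.2]

open Classical in
theorem det_groundedLaplacian_ne_zero [Fintype V] (nb : V → Finset (Option V))
    (h : ∃ p : V → Option V, (∀ v, p v ∈ nb v) ∧ Rooted p) :
    (groundedLaplacian nb).det ≠ 0 := by
  have h2 : groundedLaplacian nb = fun v => ∑ o ∈ nb v, (Pi.single v 1 - optRow o : V → ℝ) := rfl
  have h1 : (groundedLaplacian nb).det =
      ∑ p ∈ Fintype.piFinset nb, (parentMatrix p).det := by
    rw [h2]
    exact (Matrix.detRowAlternating (R := ℝ) (n := V)).toMultilinearMap.map_sum_finset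
      (fun v o => (Pi.single v 1 - optRow o : V → ℝ)) nb
  have h3 : ∀ p : V → Option V, ¬ Rooted p → (parentMatrix p).det = 0 := by
    intro p hp
    have h4 : replaceRows (parentMatrix p) Fin.elim0 Fin.elim0 = parentMatrix p := by
      funext v
      exact replaceRows_of_notMem _ _ _ fun ⟨j, _⟩ => j.elim0
    rw [← h4]
    exact det_replaceRows_of_not_rooted hp (fun j => j.elim0) _
  rw [h1]
  obtain ⟨p, hp, hr⟩ := h
  refine (Finset.sum_pos' (fun q _ => ?_) ⟨p, Fintype.mem_piFinset.2 hp, ?_⟩).ne'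
  · by_cases hq : Rooted q
    · rw [det_parentMatrix hq]; exact zero_le_one
    · rw [h3 q hq]
  · rw [det_parentMatrix hr]; exact one_pos

end FominIdentity

section ParentTree

open SimpleGraph

/-- The vertices of `B` other than the root `t`. -/
abbrev NonRoot {α : Type*} (B : Set α) (t : α) : Type _ := {x : α // x ∈ B ∧ x ≠ t}

variable {α : Type*} {B : Set α} {t : α}

/-- The vertex encoded by an element of `Option (NonRoot B t)`, where `none` stands for `t`. -/
def optVertex (o : Option (NonRoot B t)) : α := o.elim t Subtype.val

theorem optVertex_none : optVertex (none : Option (NonRoot B t)) = t := rfl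

theorem optVertex_some (x : NonRoot B t) : optVertex (some x) = x := rfl

theorem optVertex_injective : Function.Injective (optVertex : Option (NonRoot B t) → α) := by
  rintro (_ | x) (_ | y) h
  · rfl
  · exact absurd h.symm y.2.2
  · exact absurd h x.2.2
  · exact congrArg some (Subtype.ext h)

theorem optVertex_mem (ht : t ∈ B) (o : Option (NonRoot B t)) : optVertex o ∈ B := by
  rcases o with _ | x
  · exact ht
  · exact x.2.1

theorem exists_optVertex {y : α} (hy : y ∈ B) : ∃ o : Option (NonRoot B t), optVertex o = y := by
  by_cases h : y = t
  · exact ⟨none, h.symm⟩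
  · exact ⟨some ⟨y, hy, h⟩, rfl⟩

/-- The subgraph of `G` on `B` formed by the edges joining each vertex to its parent. -/
def parentTree (G : SimpleGraph α) (p : NonRoot B t → Option (NonRoot B t)) : G.Subgraph where
  verts := B
  Adj u w := G.Adj u w ∧ u ∈ B ∧ w ∈ B ∧
    ∃ x : NonRoot B t, (u = x ∧ w = optVertex (p x)) ∨ (w = x ∧ u = optVertex (p x))
  adj_sub h := h.1
  edge_vert h := h.2.1
  symm := ⟨fun _ _ h => ⟨h.1.symm, h.2.2.1, h.2.1, h.2.2.2.imp fun _ => Or.symm⟩⟩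

variable {G : SimpleGraph α} {p q : NonRoot B t → Option (NonRoot B t)}

theorem parentTree_adj_parent (ht : t ∈ B) (hp : ∀ x : NonRoot B t, G.Adj x (optVertex (p x)))
    (x : NonRoot B t) : (parentTree G p).Adj x (optVertex (p x)) :=
  ⟨hp x, x.2.1, optVertex_mem ht _, x, Or.inl ⟨rfl, rfl⟩⟩

theorem parentTree_coe_connected (ht : t ∈ B)
    (hp : ∀ x : NonRoot B t, G.Adj x (optVertex (p x))) (h : Rooted p) :
    (parentTree G p).coe.Connected := by
  have key : ∀ x : NonRoot B t,
      (parentTree G p).coe.Reachable ⟨x, x.2.1⟩ ⟨t, ht⟩ := by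
    intro x
    induction x using h.induction with
    | _ x ih =>
      have hx : (parentTree G p).coe.Adj ⟨x, x.2.1⟩ ⟨optVertex (p x), optVertex_mem ht _⟩ :=
        parentTree_adj_parent ht hp x
      refine hx.reachable.trans ?_
      rcases hpx : p x with _ | y
      · exact Reachable.refl _
      · exact ih y hpx
  have key' : ∀ x : (parentTree G p).verts, (parentTree G p).coe.Reachable x ⟨t, ht⟩ := by
    rintro ⟨x, hx⟩
    by_cases hxt : x = t
    · subst hxt
      exact Reachable.refl _
    · exact key ⟨x, hx, hxt⟩
  have : Nonempty (parentTree G p).verts := ⟨⟨t, ht⟩⟩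
  exact ⟨fun x y => (key' x).trans (key' y).symm⟩

theorem parentTree_coe_isTree (hB : B.Finite) (ht : t ∈ B)
    (hp : ∀ x : NonRoot B t, G.Adj x (optVertex (p x))) (h : Rooted p) :
    (parentTree G p).coe.IsTree := by
  have hc := parentTree_coe_connected ht hp h
  have : Finite (parentTree G p).verts := hB
  have : Finite (NonRoot B t) := Finite.of_injective
    (fun x : NonRoot B t => (⟨x, x.2.1⟩ : (parentTree G p).verts))
    fun x y hxy => Subtype.ext (Subtype.mk.inj hxy)
  rw [isTree_iff_connected_and_card]
  refine ⟨hc, le_antisymm ?_ hc.card_vert_le_card_edgeSet_add_one⟩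
  have h1 : Nat.card (parentTree G p).coe.edgeSet ≤ Nat.card (NonRoot B t) := by
    refine Nat.card_le_card_of_surjective (fun x : NonRoot B t =>
      (⟨s(⟨x, x.2.1⟩, ⟨optVertex (p x), optVertex_mem ht _⟩),
        parentTree_adj_parent ht hp x⟩ : (parentTree G p).coe.edgeSet)) ?_
    rintro ⟨e, he⟩
    induction e with
    | _ u w =>
      obtain ⟨-, -, -, x, ⟨hu, hw⟩ | ⟨hw, hu⟩⟩ := he
      · refine ⟨x, Subtype.ext (Sym2.eq_iff.2 (Or.inl ⟨?_, ?_⟩))⟩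
        · exact Subtype.ext hu.symm
        · exact Subtype.ext hw.symm
      · refine ⟨x, Subtype.ext (Sym2.eq_iff.2 (Or.inr ⟨?_, ?_⟩))⟩
        · exact Subtype.ext hw.symm
        · exact Subtype.ext hu.symm
  have h2 : Nat.card (Option (NonRoot B t)) = Nat.card (parentTree G p).verts := by
    refine Nat.card_congr (Equiv.ofBijective
      (fun o => (⟨optVertex o, optVertex_mem ht o⟩ : (parentTree G p).verts)) ⟨?_, ?_⟩)
    · exact fun a b hab => optVertex_injective (congrArg Subtype.val hab)
    · rintro ⟨y, hy⟩
      obtain ⟨o, ho⟩ := exists_optVertex (t := t) hy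
      exact ⟨o, Subtype.ext ho⟩
  rw [Finite.card_option] at h2
  omega

theorem parentTree_injective (ht : t ∈ B) (hp : ∀ x : NonRoot B t, G.Adj x (optVertex (p x)))
    (h : Rooted p) (hpq : parentTree G p = parentTree G q) : p = q := by
  funext x
  induction x using h.induction with
  | _ x ih =>
    have hx := parentTree_adj_parent ht hp x
    rw [hpq] at hx
    obtain ⟨-, -, -, x', ⟨hu, hw⟩ | ⟨hw, hu⟩⟩ := hx
    · rw [Subtype.ext hu] at hw ⊢
      exact optVertex_injective hw
    · have h1 : p x = some x' := optVertex_injective hw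
      have h2 : q x' = some x := optVertex_injective hu.symm
      have h3 : p x' = some x := (ih x' h1).trans h2
      exact absurd h3 (h.asymmetric _ _ h1)

theorem exists_parentTree_eq (T : G.Subgraph) (hTB : T.verts = B) (ht : t ∈ B)
    (hT : T.coe.IsTree) : ∃ p : NonRoot B t → Option (NonRoot B t),
      (∀ x : NonRoot B t, G.Adj x (optVertex (p x))) ∧ Rooted p ∧ parentTree G p = T := by
  subst hTB
  have step : ∀ x : NonRoot T.verts t, ∃ o : Option (NonRoot T.verts t),
      T.Adj x (optVertex o) ∧ T.coe.dist ⟨optVertex o, optVertex_mem ht o⟩ ⟨t, ht⟩ <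
        T.coe.dist ⟨x, x.2.1⟩ ⟨t, ht⟩ := by
    intro x
    have key : ∀ (a b : T.verts) (w : T.coe.Walk a b), a ≠ b →
        ∃ y, T.coe.Adj a y ∧ T.coe.dist y b < w.length := by
      intro a b w hab
      cases w with
      | nil => exact absurd rfl hab
      | cons hxy w => exact ⟨_, hxy, Nat.lt_succ_of_le (dist_le w)⟩
    obtain ⟨w, hw⟩ := hT.connected.exists_walk_length_eq_dist ⟨x, x.2.1⟩ ⟨t, ht⟩
    obtain ⟨y, hxy, hy⟩ := key _ _ w fun h => x.2.2 (Subtype.mk.inj h)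
    obtain ⟨o, ho⟩ := exists_optVertex (t := t) y.2
    obtain rfl : y = ⟨optVertex o, optVertex_mem ht o⟩ := Subtype.ext ho.symm
    exact ⟨o, hxy, hw ▸ hy⟩
  choose p hp1 hp2 using step
  have hp : ∀ x : NonRoot T.verts t, G.Adj x (optVertex (p x)) := fun x => (hp1 x).adj_sub
  have hr : Rooted p := by
    refine Subrelation.wf (r := InvImage (· < ·) fun x : NonRoot T.verts t =>
      T.coe.dist ⟨x, x.2.1⟩ ⟨t, ht⟩) ?_ (InvImage.wf _ wellFounded_lt)
    intro y x hyx
    have := hp2 x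
    rw [hyx] at this
    exact this
  refine ⟨p, hp, hr, ?_⟩
  have hle : ∀ u w, (parentTree G p).Adj u w → T.Adj u w := by
    rintro u w ⟨-, -, -, x, ⟨rfl, rfl⟩ | ⟨rfl, rfl⟩⟩
    · exact hp1 x
    · exact (hp1 x).symm
  have hc := parentTree_coe_connected ht hp hr
  have heq := (isTree_iff_minimal_connected.1 hT).eq_of_le hc fun u w h => hle u w h
  refine Subgraph.ext rfl ?_
  funext u w
  refine propext ⟨hle u w, fun h => ?_⟩
  have : T.coe.Adj ⟨u, h.fst_mem⟩ ⟨w, h.snd_mem⟩ := h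
  rw [← heq] at this
  exact this

theorem parentTree_neighborSet (ht : t ∈ B) (hp : ∀ x : NonRoot B t, G.Adj x (optVertex (p x))) :
    (parentTree G p).neighborSet t = Subtype.val '' {x : NonRoot B t | p x = none} := by
  ext y
  constructor
  · rintro ⟨-, -, -, x, ⟨hu, -⟩ | ⟨rfl, hu⟩⟩
    · exact absurd hu.symm x.2.2
    · exact ⟨x, optVertex_injective hu.symm, rfl⟩
  · rintro ⟨x, hx, rfl⟩
    have := parentTree_adj_parent ht hp x
    rw [hx] at this
    exact this.symm

theorem exists_parentTree_path (ht : t ∈ B) (hp : ∀ x : NonRoot B t, G.Adj x (optVertex (p x)))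
    (h : Rooted p) (v : NonRoot B t) :
    ∃ w : (parentTree G p).spanningCoe.Walk t v, w.IsPath ∧
      ∀ y ∈ w.support, y = t ∨ ∃ x : NonRoot B t, y = x ∧ last p x = last p v := by
  classical
  have key : ∃ w : (parentTree G p).spanningCoe.Walk v t,
      ∀ y ∈ w.support, y = t ∨ ∃ x : NonRoot B t, y = x ∧ last p x = last p v := by
    induction v using h.induction with
    | _ v ih =>
      have hv : (parentTree G p).spanningCoe.Adj v (optVertex (p v)) :=
        parentTree_adj_parent ht hp v
      rcases hpv : p v with _ | y
      · rw [hpv, optVertex_none] at hv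
        refine ⟨Walk.cons hv Walk.nil, fun y hy => ?_⟩
        rw [Walk.support_cons, List.mem_cons, Walk.mem_support_nil_iff] at hy
        exact hy.symm.imp id fun h => ⟨v, h, rfl⟩
      · rw [hpv, optVertex_some] at hv
        obtain ⟨w, hw⟩ := ih y hpv
        refine ⟨Walk.cons hv w, fun z hz => ?_⟩
        rw [Walk.support_cons, List.mem_cons] at hz
        rw [last_of_some h hpv]
        rcases hz with rfl | hz
        · exact Or.inr ⟨v, rfl, last_of_some h hpv⟩
        · exact hw z hz
  obtain ⟨w, hw⟩ := key
  refine ⟨w.reverse.bypass, w.reverse.bypass_isPath, fun y hy => hw y ?_⟩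
  have := w.reverse.support_bypass_subset_support hy
  rwa [Walk.support_reverse, List.mem_reverse] at this

theorem last_mem_support (h : Rooted p) {u v : α} (w : (parentTree G p).spanningCoe.Walk u v)
    {x a : NonRoot B t} (hv : v = x) (ha : last p x = a)
    (hu : ∀ y : NonRoot B t, u = y → last p y ≠ a) : (a : α) ∈ w.support := by
  induction w with
  | nil => exact absurd ha (hu x hv)
  | @cons u u' v huu w ih =>
    rw [Walk.support_cons, List.mem_cons]
    right
    by_cases hu' : ∀ y : NonRoot B t, u' = y → last p y ≠ a
    · exact ih hv hu'
    · push Not at hu'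
      obtain ⟨y, rfl, hy⟩ := hu'
      obtain ⟨-, -, -, z, ⟨rfl, hz⟩ | ⟨hz, rfl⟩⟩ := huu
      · have hz' : p z = some y := optVertex_injective hz.symm
        exact absurd ((last_of_some h hz').trans hy) (hu z rfl)
      · rw [← Subtype.ext hz] at hu
        rcases hpz : p y with _ | z'
        · rw [← hy, last_of_none h hpz]
          exact w.start_mem_support
        · rw [hpz] at hu
          exact absurd ((last_of_some h hpz).symm.trans hy) (hu z' rfl)

theorem last_ne_last (h : Rooted p) {x y : NonRoot B t}
    (w₁ : (parentTree G p).spanningCoe.Walk t x) (w₂ : (parentTree G p).spanningCoe.Walk t y)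
    (hw : ∀ z ∈ w₁.support, z ∈ w₂.support → z = t) : last p x ≠ last p y := by
  intro hxy
  have ht : ∀ (a z : NonRoot B t), t = z → last p z ≠ a := fun _ z hz => absurd hz.symm z.2.2
  exact (last p x).2.2 (hw _ (last_mem_support h w₁ rfl rfl (ht _))
    (last_mem_support h w₂ rfl hxy.symm (ht _)))

end ParentTree

section Planarity

/-- The four unit vectors of `ℤ²`, in counterclockwise order. -/
def dir : Fin 4 → ℤ × ℤ := ![(1, 0), (0, 1), (-1, 0), (0, -1)]

/-- A lattice path in the upper half plane from `(v, 0)` to `t`, visiting `t` only at its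
end, at time `m + 1`. -/
structure IsBranch (P : ℕ → ℤ × ℤ) (m : ℕ) (v : ℤ) (t : ℤ × ℤ) : Prop where
  zero : P 0 = (v, 0)
  final : P (m + 1) = t
  step : ∀ k < m + 1, ∃ i, P (k + 1) = P k + dir i
  nonneg : ∀ k, 0 ≤ (P k).2
  ne_final : ∀ k < m + 1, P k ≠ t

/-- The net number of crossings of the edge from `x` to `y` by the path `P` up to time `l`. -/
def edgeFlow (P : ℕ → ℤ × ℤ) (l : ℕ) (x y : ℤ × ℤ) : ℤ :=
  ∑ k ∈ Finset.range l, ((if P k = x ∧ P (k + 1) = y then 1 else 0) -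
    (if P k = y ∧ P (k + 1) = x then 1 else 0))

/-- The net number of crossings by the path `P` of the downward ray issued from the face with
lower left corner `(a, b)`. -/
def rayFlow (P : ℕ → ℤ × ℤ) (l : ℕ) (a b : ℤ) : ℤ :=
  ∑ k ∈ Finset.range l, ((if (P k).1 = a ∧ (P (k + 1)).1 = a + 1 ∧ (P k).2 ≤ b then 1 else 0) -
    (if (P k).1 = a + 1 ∧ (P (k + 1)).1 = a ∧ (P k).2 ≤ b then 1 else 0))

/-- The winding function of a path, completed by a half line below the lower boundary. -/
def winding (P : ℕ → ℤ × ℤ) (l : ℕ) (v a b : ℤ) : ℤ :=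
  rayFlow P l a b - if v ≤ a then 1 else 0

theorem step_cases {x y : ℤ × ℤ} (h : ∃ i, y = x + dir i) :
    (y.1 = x.1 + 1 ∧ y.2 = x.2) ∨ (y.1 = x.1 ∧ y.2 = x.2 + 1) ∨
      (y.1 = x.1 - 1 ∧ y.2 = x.2) ∨ (y.1 = x.1 ∧ y.2 = x.2 - 1) := by
  obtain ⟨i, rfl⟩ := h
  fin_cases i <;> simp [dir] <;> omega

theorem ray_term {x y : ℤ × ℤ}
    (h : (y.1 = x.1 + 1 ∧ y.2 = x.2) ∨ (y.1 = x.1 ∧ y.2 = x.2 + 1) ∨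
      (y.1 = x.1 - 1 ∧ y.2 = x.2) ∨ (y.1 = x.1 ∧ y.2 = x.2 - 1)) (a b : ℤ) :
    ((if y.1 = a ∧ y.2 ≤ b then (1 : ℤ) else 0) - if x.1 = a ∧ x.2 ≤ b then 1 else 0) =
     ((if x.1 = a - 1 ∧ y.1 = a - 1 + 1 ∧ x.2 ≤ b then 1 else 0) -
    (if x.1 = a - 1 + 1 ∧ y.1 = a - 1 ∧ x.2 ≤ b then 1 else 0)) -
     ((if x.1 = a ∧ y.1 = a + 1 ∧ x.2 ≤ b then 1 else 0) -
    (if x.1 = a + 1 ∧ y.1 = a ∧ x.2 ≤ b then 1 else 0)) -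
    ((if x = (a,b) ∧ y = (a, b+1) then 1 else 0) - (if x = (a,b+1) ∧ y = (a, b) then 1 else 0)) := by
  obtain ⟨x1, x2⟩ := x
  obtain ⟨y1, y2⟩ := y
  simp only [Prod.mk.injEq] at h ⊢
  rcases h with ⟨rfl, rfl⟩ | ⟨rfl, rfl⟩ | ⟨rfl, rfl⟩ | ⟨rfl, rfl⟩
  · by_cases h1 : y2 ≤ b
    · by_cases h2 : x1 = a
      · grind
      · by_cases h3 : x1 + 1 = a <;> grind
    · grind (splits := 30)
  · grind (splits := 30)
  · by_cases h1 : y2 ≤ b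
    · by_cases h2 : x1 = a
      · grind
      · by_cases h3 : x1 - 1 = a <;> grind
    · grind (splits := 30)
  · grind (splits := 30)

theorem edgeFlow_eq_zero {P : ℕ → ℤ × ℤ} {l : ℕ} {x y : ℤ × ℤ}
    (h : (∀ k ≤ l, P k ≠ x) ∨ ∀ k ≤ l, P k ≠ y) : edgeFlow P l x y = 0 := by
  refine Finset.sum_eq_zero fun k hk => ?_
  have hk' := Finset.mem_range.1 hk
  rcases h with h | h
  · simp [h k hk'.le, h (k + 1) hk']
  · simp [h k hk'.le, h (k + 1) hk']

theorem edgeFlow_swap (P : ℕ → ℤ × ℤ) (l : ℕ) (x y : ℤ × ℤ) :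
    edgeFlow P l y x = - edgeFlow P l x y := by
  rw [edgeFlow, edgeFlow, ← Finset.sum_neg_distrib]
  exact Finset.sum_congr rfl fun k _ => by ring

namespace IsBranch

variable {P : ℕ → ℤ × ℤ} {m : ℕ} {v : ℤ} {t : ℤ × ℤ}

theorem edgeFlow_final (h : IsBranch P m v t) (x : ℤ × ℤ) :
    edgeFlow P (m + 1) x t = if P m = x then 1 else 0 := by
  rw [edgeFlow, Finset.sum_range_succ, Finset.sum_eq_zero]
  · simp [h.final, h.ne_final m (Nat.lt_succ_self m)]
  · intro k hk
    have hk' := Finset.mem_range.1 hk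
    simp [h.ne_final k (by omega), h.ne_final (k + 1) (by omega)]

theorem winding_vertical (h : IsBranch P m v t) (a b : ℤ) :
    winding P (m + 1) v a b - winding P (m + 1) v a (b - 1) =
      edgeFlow P (m + 1) (a, b) (a + 1, b) := by
  rw [winding, winding, sub_sub_sub_cancel_right, rayFlow, rayFlow, edgeFlow,
    ← Finset.sum_sub_distrib]
  refine Finset.sum_congr rfl fun k hk => ?_
  have hs := step_cases (h.step k (Finset.mem_range.1 hk))
  simp only [Prod.ext_iff]
  split_ifs <;> omega

theorem winding_horizontal (h : IsBranch P m v t) (a : ℤ) {b : ℤ} (hb : 0 ≤ b) :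
    winding P (m + 1) v a b - winding P (m + 1) v (a - 1) b =
      - edgeFlow P (m + 1) (a, b) (a, b + 1) - if t.1 = a ∧ t.2 ≤ b then 1 else 0 := by
  have h1 : ∑ k ∈ Finset.range (m + 1),
      ((if (P (k + 1)).1 = a ∧ (P (k + 1)).2 ≤ b then (1 : ℤ) else 0) -
        if (P k).1 = a ∧ (P k).2 ≤ b then 1 else 0) =
      (if t.1 = a ∧ t.2 ≤ b then 1 else 0) - if v = a then 1 else 0 := by
    rw [Finset.sum_range_sub (fun k => if (P k).1 = a ∧ (P k).2 ≤ b then (1 : ℤ) else 0)]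
    simp [h.final, h.zero, hb]
  have h2 : ∑ k ∈ Finset.range (m + 1),
      ((if (P (k + 1)).1 = a ∧ (P (k + 1)).2 ≤ b then (1 : ℤ) else 0) -
        if (P k).1 = a ∧ (P k).2 ≤ b then 1 else 0) =
      rayFlow P (m + 1) (a - 1) b - rayFlow P (m + 1) a b
        - edgeFlow P (m + 1) (a, b) (a, b + 1) := by
    rw [rayFlow, rayFlow, edgeFlow, ← Finset.sum_sub_distrib, ← Finset.sum_sub_distrib]
    refine Finset.sum_congr rfl fun k hk => ?_
    exact ray_term (step_cases (h.step k (Finset.mem_range.1 hk))) a b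
  rw [winding, winding]
  have h3 : ((if v ≤ a then 1 else 0 : ℤ) - if v ≤ a - 1 then 1 else 0) = if v = a then 1 else 0 := by
    split_ifs <;> omega
  linarith

theorem winding_below (h : IsBranch P m v t) (a : ℤ) :
    winding P (m + 1) v a (-1) = - if v ≤ a then 1 else 0 := by
  rw [winding, rayFlow, Finset.sum_eq_zero, zero_sub]
  intro k _
  have := h.nonneg k
  split_ifs <;> omega

end IsBranch

section TwoBranches

variable {P Q R : ℕ → ℤ × ℤ} {m n l : ℕ} {u v w : ℤ} {t : ℤ × ℤ}

theorem winding_sub_around (hP : IsBranch P m u t) (hQ : IsBranch Q n v t) {a b c : ℤ}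
    (hb : 0 ≤ b) (hxP : ∀ k ≤ m + 1, P k ≠ (a, b)) (hxQ : ∀ k ≤ n + 1, Q k ≠ (a, b))
    (hc : ∃ a' b', (a' = a ∨ a' = a - 1) ∧ (b' = b ∨ b' = b - 1) ∧
      winding P (m + 1) u a' b' - winding Q (n + 1) v a' b' = c) :
    ∀ a' b', (a' = a ∨ a' = a - 1) → (b' = b ∨ b' = b - 1) →
      winding P (m + 1) u a' b' - winding Q (n + 1) v a' b' = c := by
  have e1 := hP.winding_vertical a b
  have e2 := hQ.winding_vertical a b
  have e3 := hP.winding_vertical (a - 1) b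
  have e4 := hQ.winding_vertical (a - 1) b
  have e5 := hP.winding_horizontal a hb
  have e6 := hQ.winding_horizontal a hb
  rw [sub_add_cancel] at e3 e4
  rw [edgeFlow_eq_zero (Or.inl hxP)] at e1 e5
  rw [edgeFlow_eq_zero (Or.inl hxQ)] at e2 e6
  rw [edgeFlow_eq_zero (Or.inr hxP)] at e3
  rw [edgeFlow_eq_zero (Or.inr hxQ)] at e4
  obtain ⟨a', b', rfl | rfl, rfl | rfl, hc⟩ := hc <;>
  · rintro a'' b'' (rfl | rfl) (rfl | rfl) <;> omega

theorem winding_sub_along (hP : IsBranch P m u t) (hQ : IsBranch Q n v t)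
    (hR : IsBranch R l w t) (hPR : ∀ i ≤ m, ∀ j ≤ l, P i ≠ R j)
    (hQR : ∀ i ≤ n, ∀ j ≤ l, Q i ≠ R j) {j : ℕ} (hj : j ≤ l) :
    ∀ a b, (a = (R j).1 ∨ a = (R j).1 - 1) → (b = (R j).2 ∨ b = (R j).2 - 1) →
      winding P (m + 1) u a b - winding Q (n + 1) v a b =
        (if v ≤ w then 1 else 0) - if u ≤ w then 1 else 0 := by
  have hRP : ∀ j ≤ l, ∀ k ≤ m + 1, P k ≠ ((R j).1, (R j).2) := by
    intro j hj k hk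
    rcases Nat.lt_or_ge m k with h | h
    · rw [show k = m + 1 by omega, hP.final]
      exact (hR.ne_final j (by omega)).symm
    · exact hPR k h j hj
  have hRQ : ∀ j ≤ l, ∀ k ≤ n + 1, Q k ≠ ((R j).1, (R j).2) := by
    intro j hj k hk
    rcases Nat.lt_or_ge n k with h | h
    · rw [show k = n + 1 by omega, hQ.final]
      exact (hR.ne_final j (by omega)).symm
    · exact hQR k h j hj
  induction j with
  | zero =>
    refine winding_sub_around hP hQ (hR.nonneg 0) (hRP 0 hj) (hRQ 0 hj)
      ⟨w, -1, Or.inl (by rw [hR.zero]), Or.inr (by rw [hR.zero]; rfl), ?_⟩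
    rw [hP.winding_below, hQ.winding_below]
    ring
  | succ j ih =>
    have ih := ih (by omega)
    refine winding_sub_around hP hQ (hR.nonneg _) (hRP _ hj) (hRQ _ hj) ?_
    rcases step_cases (hR.step j (by omega)) with hs | hs | hs | hs
    · exact ⟨(R j).1, (R j).2, by omega, by omega, ih _ _ (by omega) (by omega)⟩
    · exact ⟨(R j).1, (R j).2, by omega, by omega, ih _ _ (by omega) (by omega)⟩
    · exact ⟨(R j).1 - 1, (R j).2, by omega, by omega, ih _ _ (by omega) (by omega)⟩
    · exact ⟨(R j).1, (R j).2 - 1, by omega, by omega, ih _ _ (by omega) (by omega)⟩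

theorem IsBranch.winding_at_final (hP : IsBranch P m u t) (ht : 0 ≤ t.2) {i : Fin 4}
    (hi : P m = t + dir i) :
    winding P (m + 1) u t.1 t.2 - winding P (m + 1) u t.1 (t.2 - 1) =
        (- if i = 0 then 1 else 0) ∧
      winding P (m + 1) u (t.1 - 1) t.2 - winding P (m + 1) u (t.1 - 1) (t.2 - 1) =
        (if i = 2 then 1 else 0) ∧
      winding P (m + 1) u t.1 t.2 - winding P (m + 1) u (t.1 - 1) t.2 =
        (if i = 1 then 1 else 0) - 1 := by
  have e1 := hP.winding_vertical t.1 t.2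
  have e3 := hP.winding_vertical (t.1 - 1) t.2
  have e5 := hP.winding_horizontal t.1 ht
  rw [sub_add_cancel] at e3
  rw [edgeFlow_swap, hP.edgeFlow_final] at e1 e5
  rw [hP.edgeFlow_final] at e3
  rw [hi] at e1 e3 e5
  obtain ⟨t1, t2⟩ := t
  fin_cases i <;> simp [dir] at e1 e3 e5 ⊢ <;> omega

theorem eq_on_shared_faces {W : ℤ → ℤ → ℤ} {c : ℤ} {i : Fin 4}
    (h : ∀ a b, (a = (t + dir i).1 ∨ a = (t + dir i).1 - 1) →
      (b = (t + dir i).2 ∨ b = (t + dir i).2 - 1) → W a b = c) :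
    (i = 0 ∨ i = 1 → W t.1 t.2 = c) ∧ (i = 1 ∨ i = 2 → W (t.1 - 1) t.2 = c) ∧
      (i = 2 ∨ i = 3 → W (t.1 - 1) (t.2 - 1) = c) ∧ (i = 3 ∨ i = 0 → W t.1 (t.2 - 1) = c) := by
  refine ⟨?_, ?_, ?_, ?_⟩ <;> rintro (rfl | rfl) <;> apply h <;> simp [dir, sub_eq_add_neg]

/-- Three disjoint branches from the lower boundary reach their common endpoint in
counterclockwise order. -/
theorem ccw_of_branches (hP : IsBranch P m u t) (hQ : IsBranch Q n v t)
    (hR : IsBranch R l w t) (huv : u < v) (hvw : v < w) (ht : 0 < t.2)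
    (hPQ : ∀ i ≤ m, ∀ j ≤ n, P i ≠ Q j) (hPR : ∀ i ≤ m, ∀ j ≤ l, P i ≠ R j)
    (hQR : ∀ i ≤ n, ∀ j ≤ l, Q i ≠ R j) {i j k : Fin 4} (hi : P m = t + dir i)
    (hj : Q n = t + dir j) (hk : R l = t + dir k) :
    0 < j - i ∧ j - i < k - i := by
  have hij : i ≠ j := by
    rintro rfl
    exact hPQ m le_rfl n le_rfl (hi.trans hj.symm)
  have hik : i ≠ k := by
    rintro rfl
    exact hPR m le_rfl l le_rfl (hi.trans hk.symm)
  have hjk : j ≠ k := by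
    rintro rfl
    exact hQR n le_rfl l le_rfl (hj.trans hk.symm)
  have a1 := hP.winding_at_final ht.le hi
  have a2 := hQ.winding_at_final ht.le hj
  have a3 := hR.winding_at_final ht.le hk
  have b1 := winding_sub_along hQ hR hP (fun a ha b hb => (hPQ b hb a ha).symm)
    (fun a ha b hb => (hPR b hb a ha).symm) le_rfl
  have b2 := winding_sub_along hP hR hQ hPQ (fun a ha b hb => (hQR b hb a ha).symm) le_rfl
  have b3 := winding_sub_along hP hQ hR hPR hQR le_rfl
  rw [hi, if_neg (by omega), if_neg (by omega)] at b1
  rw [hj, if_neg (by omega), if_pos (by omega)] at b2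
  rw [hk, if_pos (by omega), if_pos (by omega)] at b3
  have b1 := eq_on_shared_faces b1
  have b2 := eq_on_shared_faces b2
  have b3 := eq_on_shared_faces b3
  clear hi hj hk hPQ hPR hQR
  fin_cases i <;> fin_cases j <;> fin_cases k <;> first
    | decide
    | exact absurd rfl hij
    | exact absurd rfl hik
    | exact absurd rfl hjk
    | exfalso; simp at a1 a2 a3 b1 b2 b3; omega

end TwoBranches

end Planarity

section BoxTrees

variable {n : ℕ} {t : ℤ × ℤ}

theorem Bgraph_adj {x y : ℤ × ℤ} : (Bgraph n).Adj x y ↔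
    x ∈ Bbox n ∧ y ∈ Bbox n ∧ ∃ i, y = x + dir i := by
  have key : (x.1 - y.1) ^ 2 + (x.2 - y.2) ^ 2 = 1 ↔ ∃ i, y = x + dir i := by
    obtain ⟨x1, x2⟩ := x
    obtain ⟨y1, y2⟩ := y
    constructor
    · intro h
      simp only at h
      have h1 : x1 - y1 ≤ 1 := by nlinarith
      have h2 : -1 ≤ x1 - y1 := by nlinarith
      have h3 : x2 - y2 ≤ 1 := by nlinarith
      have h4 : -1 ≤ x2 - y2 := by nlinarith
      obtain ⟨a, ha⟩ : ∃ a, a = x1 - y1 := ⟨_, rfl⟩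
      obtain ⟨b, hb⟩ : ∃ b, b = x2 - y2 := ⟨_, rfl⟩
      rw [← ha] at h h1 h2
      rw [← hb] at h h3 h4
      have : (a = -1 ∧ b = 0) ∨ (a = 0 ∧ b = -1) ∨ (a = 1 ∧ b = 0) ∨ (a = 0 ∧ b = 1) := by
        clear ha hb
        interval_cases a <;> interval_cases b <;> simp at h ⊢
      rcases this with h | h | h | h
      · exact ⟨0, by simp [dir]; omega⟩
      · exact ⟨1, by simp [dir]; omega⟩
      · exact ⟨2, by simp [dir]; omega⟩
      · exact ⟨3, by simp [dir]; omega⟩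
    · rintro ⟨i, hi⟩
      rw [hi]
      fin_cases i <;> simp [dir]
  rw [← key, Bgraph, SimpleGraph.fromRel_adj]
  constructor
  · rintro ⟨-, h | h⟩
    · exact h
    · exact ⟨h.2.1, h.1, by linarith [h.2.2]⟩
  · rintro ⟨h1, h2, h3⟩
    refine ⟨?_, Or.inl ⟨h1, h2, h3⟩⟩
    rintro rfl
    simp at h3

theorem Bbox_finite (n : ℕ) : (Bbox n).Finite := by
  refine (Set.finite_Icc ((-n : ℤ), (0 : ℤ)) ((n : ℤ), (2 * n : ℤ))).subset ?_
  rintro ⟨x, y⟩ ⟨h1, h2, h3, h4⟩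
  exact ⟨⟨h1, h3⟩, ⟨h2, h4⟩⟩

noncomputable instance (n : ℕ) (t : ℤ × ℤ) : Fintype (NonRoot (Bbox n) t) :=
  have : Finite (NonRoot (Bbox n) t) := Set.Finite.subset (Bbox_finite n) fun _ h => h.1
  Fintype.ofFinite _

open Classical in
/-- The possible parents of a vertex of the box. -/
noncomputable def boxNeighbors (n : ℕ) (t : ℤ × ℤ) (x : NonRoot (Bbox n) t) :
    Finset (Option (NonRoot (Bbox n) t)) :=
  Finset.univ.filter fun o => (Bgraph n).Adj x (optVertex o)

theorem mem_boxNeighbors {x : NonRoot (Bbox n) t} {o : Option (NonRoot (Bbox n) t)} :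
    o ∈ boxNeighbors n t x ↔ (Bgraph n).Adj x (optVertex o) := by
  simp [boxNeighbors]

theorem card_trees (ht : t ∈ Bbox n) (Q : (Bgraph n).Subgraph → Prop)
    (R : (NonRoot (Bbox n) t → Option (NonRoot (Bbox n) t)) → Prop)
    (hQR : ∀ p, (∀ v, p v ∈ boxNeighbors n t v) → Rooted p →
      (Q (parentTree (Bgraph n) p) ↔ R p)) [DecidablePred R]
    [DecidablePred fun p : NonRoot (Bbox n) t → Option (NonRoot (Bbox n) t) =>
      (∀ v, p v ∈ boxNeighbors n t v) ∧ Rooted p ∧ R p]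
    [Fintype (NonRoot (Bbox n) t → Option (NonRoot (Bbox n) t))] :
    Nat.card {T : (Bgraph n).Subgraph // (T.verts = Bbox n ∧ T.coe.IsTree) ∧ Q T} =
      (Finset.univ.filter fun p : NonRoot (Bbox n) t → Option (NonRoot (Bbox n) t) =>
        (∀ v, p v ∈ boxNeighbors n t v) ∧ Rooted p ∧ R p).card := by
  rw [← Fintype.card_subtype, ← Nat.card_eq_fintype_card]
  symm
  have adj : ∀ {p : NonRoot (Bbox n) t → Option (NonRoot (Bbox n) t)},
      (∀ v, p v ∈ boxNeighbors n t v) → ∀ x : NonRoot (Bbox n) t, (Bgraph n).Adj x (optVertex (p x)) :=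
    fun h x => mem_boxNeighbors.1 (h x)
  refine Nat.card_congr (Equiv.ofBijective (fun p => ⟨parentTree (Bgraph n) p.1, ⟨rfl,
    parentTree_coe_isTree (Bbox_finite n) ht (adj p.2.1) p.2.2.1⟩,
    (hQR p.1 p.2.1 p.2.2.1).2 p.2.2.2⟩) ⟨?_, ?_⟩)
  · intro p q hpq
    exact Subtype.ext (parentTree_injective ht (adj p.2.1) p.2.2.1 (Subtype.mk.inj hpq))
  · rintro ⟨T, ⟨hTB, hT⟩, hQ⟩
    obtain ⟨p, hp, hr, rfl⟩ := exists_parentTree_eq T hTB ht hT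
    have hp' : ∀ v, p v ∈ boxNeighbors n t v := fun x => mem_boxNeighbors.2 (hp x)
    exact ⟨⟨p, hp', hr, (hQR p hp' hr).1 hQ⟩, rfl⟩

theorem hasTripod_iff (ht : t ∈ Bbox n) {p : NonRoot (Bbox n) t → Option (NonRoot (Bbox n) t)}
    (hp : ∀ v, p v ∈ boxNeighbors n t v) (h : Rooted p) (x y z : NonRoot (Bbox n) t) :
    HasTripod n (parentTree (Bgraph n) p) t x y z ↔
      last p x ≠ last p y ∧ last p x ≠ last p z ∧ last p y ≠ last p z := by
  have hp' : ∀ x : NonRoot (Bbox n) t, (Bgraph n).Adj x (optVertex (p x)) := fun x => mem_boxNeighbors.1 (hp x)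
  constructor
  · rintro ⟨w₁, w₂, w₃, -, -, -, h12, h13, h23⟩
    exact ⟨last_ne_last h w₁ w₂ h12, last_ne_last h w₁ w₃ h13, last_ne_last h w₂ w₃ h23⟩
  · rintro ⟨h12, h13, h23⟩
    obtain ⟨w₁, hw₁, h₁⟩ := exists_parentTree_path ht hp' h x
    obtain ⟨w₂, hw₂, h₂⟩ := exists_parentTree_path ht hp' h y
    obtain ⟨w₃, hw₃, h₃⟩ := exists_parentTree_path ht hp' h z
    have disj : ∀ {a b : NonRoot (Bbox n) t}, a ≠ b → ∀ u : ℤ × ℤ,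
        (u = t ∨ ∃ x : NonRoot (Bbox n) t, u = x ∧ last p x = a) →
        (u = t ∨ ∃ x : NonRoot (Bbox n) t, u = x ∧ last p x = b) → u = t := by
      rintro a b hab u (h | ⟨x, rfl, hx⟩) (h' | ⟨y, hxy, hy⟩)
      · exact h
      · exact h
      · exact h'
      · rw [Subtype.ext hxy] at hx
        exact absurd (hx.symm.trans hy) hab
    exact ⟨w₁, w₂, w₃, hw₁, hw₂, hw₃, fun u ha hb => disj h12 u (h₁ u ha) (h₂ u hb),
      fun u ha hb => disj h13 u (h₁ u ha) (h₃ u hb),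
      fun u ha hb => disj h23 u (h₂ u ha) (h₃ u hb)⟩

theorem exists_branch {p : NonRoot (Bbox n) t → Option (NonRoot (Bbox n) t)} (ht : t ∈ Bbox n)
    (hp : ∀ v, p v ∈ boxNeighbors n t v) (h : Rooted p) (v : NonRoot (Bbox n) t) :
    ∃ (P : ℕ → ℤ × ℤ) (m : ℕ), P 0 = v ∧ P (m + 1) = t ∧
      (∀ k < m + 1, ∃ i, P (k + 1) = P k + dir i) ∧ (∀ k, 0 ≤ (P k).2) ∧ P m = last p v ∧
      ∀ k < m + 1, ∃ x : NonRoot (Bbox n) t, P k = x ∧ last p x = last p v := by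
  induction v using h.induction with
  | _ v ih =>
    have hv := Bgraph_adj.1 (mem_boxNeighbors.1 (hp v))
    rcases hpv : p v with _ | y
    · rw [hpv, optVertex_none] at hv
      refine ⟨fun k => if k = 0 then v else t, 0, rfl, rfl, ?_, ?_, ?_, ?_⟩
      · intro k hk
        obtain rfl : k = 0 := by omega
        exact hv.2.2
      · intro k
        simp only
        split_ifs
        · exact v.2.1.2.2.1
        · exact ht.2.2.1
      · rw [last_of_none h hpv]
        rfl
      · intro k hk
        obtain rfl : k = 0 := by omega
        exact ⟨v, rfl, rfl⟩
    · obtain ⟨P, m, h0, hm, hs, hn, hl, hx⟩ := ih y hpv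
      rw [hpv, optVertex_some] at hv
      rw [last_of_some h hpv]
      refine ⟨fun k => k.casesOn (v : ℤ × ℤ) P, m + 1, rfl, hm, ?_, ?_, hl, ?_⟩
      · rintro (_ | k) hk
        · change ∃ i, P 0 = _
          rw [h0]
          exact hv.2.2
        · exact hs k (by omega)
      · rintro (_ | k)
        · exact v.2.1.2.2.1
        · exact hn k
      · rintro (_ | k) hk
        · exact ⟨v, rfl, last_of_some h hpv⟩
        · exact hx k (by omega)

theorem ccw_of_rooted {p : NonRoot (Bbox n) t → Option (NonRoot (Bbox n) t)} (ht : t ∈ Bbox n)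
    (ht' : 0 < t.2) (hp : ∀ v, p v ∈ boxNeighbors n t v) (h : Rooted p)
    {x y z : NonRoot (Bbox n) t} {u v w : ℤ} (hx : (x : ℤ × ℤ) = (u, 0))
    (hy : (y : ℤ × ℤ) = (v, 0)) (hz : (z : ℤ × ℤ) = (w, 0)) (huv : u < v) (hvw : v < w)
    (hxy : last p x ≠ last p y) (hxz : last p x ≠ last p z) (hyz : last p y ≠ last p z)
    {i j k : Fin 4} (hi : ((last p x : NonRoot (Bbox n) t) : ℤ × ℤ) = t + dir i)
    (hj : ((last p y : NonRoot (Bbox n) t) : ℤ × ℤ) = t + dir j) (hk : ((last p z : NonRoot (Bbox n) t) : ℤ × ℤ) = t + dir k) :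
    0 < j - i ∧ j - i < k - i := by
  obtain ⟨P, m, hP0, hP1, hP2, hP3, hP4, hP5⟩ := exists_branch ht hp h x
  obtain ⟨Q, m', hQ0, hQ1, hQ2, hQ3, hQ4, hQ5⟩ := exists_branch ht hp h y
  obtain ⟨R, l, hR0, hR1, hR2, hR3, hR4, hR5⟩ := exists_branch ht hp h z
  have ne : ∀ {X : ℕ → ℤ × ℤ} {m : ℕ} {x : NonRoot (Bbox n) t},
      (∀ k < m + 1, ∃ x' : NonRoot (Bbox n) t, X k = x' ∧ last p x' = last p x) →
      ∀ k < m + 1, X k ≠ t := by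
    intro X m x hX k hk
    obtain ⟨x', hx', -⟩ := hX k hk
    rw [hx']
    exact x'.2.2
  have disj : ∀ {X Y : ℕ → ℤ × ℤ} {m m' : ℕ} {x y : NonRoot (Bbox n) t},
      (∀ k < m + 1, ∃ x' : NonRoot (Bbox n) t, X k = x' ∧ last p x' = last p x) →
      (∀ k < m' + 1, ∃ y' : NonRoot (Bbox n) t, Y k = y' ∧ last p y' = last p y) →
      last p x ≠ last p y → ∀ i ≤ m, ∀ j ≤ m', X i ≠ Y j := by
    intro X Y m m' x y hX hY hxy i hi j hj hij
    obtain ⟨x', hx', hx''⟩ := hX i (by omega)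
    obtain ⟨y', hy', hy''⟩ := hY j (by omega)
    obtain rfl : x' = y' := Subtype.ext (hx'.symm.trans (hij.trans hy'))
    exact hxy (hx''.symm.trans hy'')
  exact ccw_of_branches (P := P) (Q := Q) (R := R) ⟨hP0.trans hx, hP1, hP2, hP3, ne hP5⟩
    ⟨hQ0.trans hy, hQ1, hQ2, hQ3, ne hQ5⟩ ⟨hR0.trans hz, hR1, hR2, hR3, ne hR5⟩ huv hvw ht'
    (disj hP5 hQ5 hxy) (disj hP5 hR5 hxz) (disj hQ5 hR5 hyz) (hP4.trans hi) (hQ4.trans hj)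
    (hR4.trans hk)

end BoxTrees

section TripodWeights

theorem det_indicator_ccw {x : Fin 3 → Fin 4} (d : Fin 4)
    (h : x 0 ≠ x 1 → x 0 ≠ x 2 → x 1 ≠ x 2 → 0 < x 1 - x 0 ∧ x 1 - x 0 < x 2 - x 0) :
    (Matrix.of fun i j => if x i = d.succAbove j then (1 : ℝ) else 0).det =
      if (x 0 ≠ x 1 ∧ x 0 ≠ x 2 ∧ x 1 ≠ x 2) ∧ ∀ i, x i ≠ d then 1 else 0 := by
  have key : ∀ a b c d : Fin 4, (a ≠ b → a ≠ c → b ≠ c → 0 < b - a ∧ b - a < c - a) →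
      (let f : Fin 4 → Fin 3 → ℤ := fun y j => if y = d.succAbove j then 1 else 0
      f a 0 * f b 1 * f c 2 - f a 0 * f b 2 * f c 1 - f a 1 * f b 0 * f c 2
        + f a 1 * f b 2 * f c 0 + f a 2 * f b 0 * f c 1 - f a 2 * f b 1 * f c 0) =
      if (a ≠ b ∧ a ≠ c ∧ b ≠ c) ∧ a ≠ d ∧ b ≠ d ∧ c ≠ d then 1 else 0 := by
    decide
  have := congrArg (Int.cast : ℤ → ℝ) (key (x 0) (x 1) (x 2) d h)
  rw [Matrix.det_fin_three]
  simp only [Matrix.of_apply]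
  push_cast at this
  rw [this]
  refine if_congr (and_congr_right fun _ => ?_) rfl rfl
  rw [Fin.forall_fin_succ, Fin.forall_fin_two]
  rfl

theorem sum_missing (x : Fin 3 → Fin 4) :
    (∑ d : Fin 4, if (x 0 ≠ x 1 ∧ x 0 ≠ x 2 ∧ x 1 ≠ x 2) ∧ ∀ i, x i ≠ d then (1 : ℝ) else 0) =
      if x 0 ≠ x 1 ∧ x 0 ≠ x 2 ∧ x 1 ≠ x 2 then 1 else 0 := by
  have key : ∀ a b c : Fin 4,
      (∑ d : Fin 4, if (a ≠ b ∧ a ≠ c ∧ b ≠ c) ∧ a ≠ d ∧ b ≠ d ∧ c ≠ d then (1 : ℕ) else 0) =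
      if a ≠ b ∧ a ≠ c ∧ b ≠ c then 1 else 0 := by
    decide
  have := congrArg (Nat.cast : ℕ → ℝ) (key (x 0) (x 1) (x 2))
  push_cast at this
  rw [← this]
  refine Finset.sum_congr rfl fun d _ => if_congr (and_congr_right fun _ => ?_) rfl rfl
  rw [Fin.forall_fin_succ, Fin.forall_fin_two]
  rfl

theorem exists_eq_of_ne_missing {x : Fin 3 → Fin 4} {d : Fin 4}
    (h : x 0 ≠ x 1 ∧ x 0 ≠ x 2 ∧ x 1 ≠ x 2) (hd : ∀ i, x i ≠ d) (j : Fin 3) :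
    ∃ i, x i = d.succAbove j := by
  have key : ∀ a b c d : Fin 4, a ≠ b ∧ a ≠ c ∧ b ≠ c → a ≠ d → b ≠ d → c ≠ d → ∀ j : Fin 3,
      a = d.succAbove j ∨ b = d.succAbove j ∨ c = d.succAbove j := by
    decide
  rcases key _ _ _ d h (hd 0) (hd 1) (hd 2) j with h | h | h
  exacts [⟨0, h⟩, ⟨1, h⟩, ⟨2, h⟩]

theorem det_snoc_fin_four (M : Fin 3 → Fin 4 → ℝ) (w : Fin 4 → ℝ) :
    (Matrix.of fun i j => (Fin.snoc M w : Fin 4 → Fin 4 → ℝ) i j).det =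
      - ∑ j : Fin 4, (-1) ^ (j : ℕ) * w j *
        (Matrix.of fun i k => M i (j.succAbove k)).det := by
  rw [Matrix.det_succ_row _ (Fin.last 3), ← Finset.sum_neg_distrib]
  refine Finset.sum_congr rfl fun j _ => ?_
  have h1 : (Matrix.of fun i j => (Fin.snoc M w : Fin 4 → Fin 4 → ℝ) i j).submatrix
      (Fin.last 3).succAbove j.succAbove = Matrix.of fun i k => M i (j.succAbove k) := by
    ext i k
    simp only [Matrix.submatrix_apply, Matrix.of_apply, Fin.succAbove_last, Fin.snoc_castSucc]
  rw [h1, Matrix.of_apply, Fin.snoc_last, pow_add]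
  simp
  ring

variable {n : ℕ} {t : ℤ × ℤ}

/-- The branches of `p` from the vertices `v i` arrive at the root through distinct edges. -/
def DistinctLast {V : Type*} (p : V → Option V) (v : Fin 3 → V) : Prop :=
  last p (v 0) ≠ last p (v 1) ∧ last p (v 0) ≠ last p (v 2) ∧ last p (v 1) ≠ last p (v 2)

theorem exists_last_eq {p : NonRoot (Bbox n) t → Option (NonRoot (Bbox n) t)}
    (hp : ∀ v, p v ∈ boxNeighbors n t v) {a : Fin 4 → NonRoot (Bbox n) t}
    (ha : ∀ j, (a j : ℤ × ℤ) = t + dir j) {x : NonRoot (Bbox n) t} (hx : p x = none) :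
    ∃ j, x = a j := by
  have h := hp x
  rw [hx, mem_boxNeighbors, optVertex_none] at h
  obtain ⟨-, -, i, hi⟩ := Bgraph_adj.1 h.symm
  exact ⟨i, Subtype.ext (hi.trans (ha i).symm)⟩

open Classical in
theorem minor_eq {p : NonRoot (Bbox n) t → Option (NonRoot (Bbox n) t)} (ht : t ∈ Bbox n)
    (ht' : 0 < t.2) (hp : ∀ v, p v ∈ boxNeighbors n t v) (h : Rooted p)
    {a : Fin 4 → NonRoot (Bbox n) t} (ha : ∀ j, (a j : ℤ × ℤ) = t + dir j)
    (hinj : Function.Injective a)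
    {v : Fin 3 → NonRoot (Bbox n) t} {c : Fin 3 → ℤ} (hv : ∀ i, (v i : ℤ × ℤ) = (c i, 0))
    (hc : c 0 < c 1) (hc' : c 1 < c 2) :
    ∃ x : Fin 3 → Fin 4, (∀ i, last p (v i) = a (x i)) ∧
      (DistinctLast p v ↔ x 0 ≠ x 1 ∧ x 0 ≠ x 2 ∧ x 1 ≠ x 2) ∧ ∀ d : Fin 4,
      (Matrix.of fun i j => if last p (v i) = a (d.succAbove j) then (1 : ℝ) else 0).det =
      if (x 0 ≠ x 1 ∧ x 0 ≠ x 2 ∧ x 1 ≠ x 2) ∧ ∀ i, x i ≠ d then 1 else 0 := by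
  choose x hx using fun i => exists_last_eq hp ha (parent_last h (v i))
  have hD : DistinctLast p v ↔ x 0 ≠ x 1 ∧ x 0 ≠ x 2 ∧ x 1 ≠ x 2 := by
    simp only [DistinctLast, hx, ne_eq, hinj.eq_iff]
  refine ⟨x, hx, hD, fun d => ?_⟩
  rw [← det_indicator_ccw]
  · simp only [hx, hinj.eq_iff]
  · intro h1 h2 h3
    obtain ⟨h1, h2, h3⟩ := hD.2 ⟨h1, h2, h3⟩
    refine ccw_of_rooted ht ht' hp h (hv 0) (hv 1) (hv 2) hc hc' h1 h2 h3 ?_ ?_ ?_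
    all_goals rw [hx, ha]

open Classical in
theorem tripod_weights (ht : t ∈ Bbox n) (ht' : 0 < t.2)
    {a : Fin 4 → NonRoot (Bbox n) t} (ha : ∀ j, (a j : ℤ × ℤ) = t + dir j)
    {v : Fin 3 → NonRoot (Bbox n) t} {c : Fin 3 → ℤ} (hv : ∀ i, (v i : ℤ × ℤ) = (c i, 0))
    (hc : c 0 < c 1) (hc' : c 1 < c 2) (G : Matrix (NonRoot (Bbox n) t) (NonRoot (Bbox n) t) ℝ)
    (hG : groundedLaplacian (boxNeighbors n t) * G = 1) :
    ∃ m : Fin 4 → ℝ, (∀ d, 0 ≤ m d) ∧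
      ((Finset.univ.filter fun p : NonRoot (Bbox n) t → Option (NonRoot (Bbox n) t) =>
        (∀ v, p v ∈ boxNeighbors n t v) ∧ Rooted p ∧ DistinctLast p v).card : ℝ) = ∑ d, m d ∧
      ((Finset.univ.filter fun p : NonRoot (Bbox n) t → Option (NonRoot (Bbox n) t) =>
        (∀ v, p v ∈ boxNeighbors n t v) ∧ Rooted p ∧ DistinctLast p v ∧
          ∀ j, p (a j) = none).card : ℝ) =
        ∑ j, m j * ((-1) ^ (j : ℕ) * ∑ d : Fin 4, (-1) ^ (d : ℕ) * G (a d) (a j)) := by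
  have hinj : Function.Injective a := by
    intro i j hij
    have : dir i = dir j := by
      have := congrArg Subtype.val hij
      rw [ha, ha] at this
      exact add_left_cancel this
    revert i j
    have key : ∀ i j, dir i = dir j → i = j := by decide
    exact fun i j _ h => key i j h
  have hnb : ∀ j, none ∈ boxNeighbors n t (a j) := by
    intro j
    rw [mem_boxNeighbors, optVertex_none]
    exact (Bgraph_adj.2 ⟨ht, (a j).2.1, j, ha j⟩).symm
  set L := groundedLaplacian (boxNeighbors n t)
  have hm : ∀ d : Fin 4, L.det * (Matrix.of fun i j => G (v i) (a (d.succAbove j))).det =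
      ∑ p : NonRoot (Bbox n) t → Option (NonRoot (Bbox n) t) with
        (∀ v, p v ∈ boxNeighbors n t v) ∧ Rooted p ∧ ∀ j, p (a (d.succAbove j)) = none,
      (Matrix.of fun i j => if last p (v i) = a (d.succAbove j) then (1 : ℝ) else 0).det := by
    intro d
    exact (fomin_identity _ G hG (hinj.comp Fin.succAbove_right_injective) (fun j => hnb _)
      v).symm
  have hm4 : ∀ d : Fin 4, ∑ p : NonRoot (Bbox n) t → Option (NonRoot (Bbox n) t) with
        (∀ v, p v ∈ boxNeighbors n t v) ∧ Rooted p ∧ ∀ j, p (a j) = none,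
      (Matrix.of fun i j => if last p (v i) = a (d.succAbove j) then (1 : ℝ) else 0).det =
      ∑ j : Fin 4, (-1) ^ (d : ℕ) * (-1) ^ (j : ℕ) * G (a d) (a j) *
        (L.det * (Matrix.of fun i k => G (v i) (a (j.succAbove k))).det) := by
    intro d
    have h4 := fomin_identity _ G hG hinj hnb (Fin.snoc v (a d))
    have h5 : (Matrix.of fun i j => G ((Fin.snoc v (a d) : Fin 4 → NonRoot (Bbox n) t) i) (a j))
        = Matrix.of fun i j => (Fin.snoc (fun i j => G (v i) (a j)) (fun j => G (a d) (a j)) :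
          Fin 4 → Fin 4 → ℝ) i j := by
      ext i j
      refine Fin.lastCases ?_ (fun i => ?_) i <;>
        simp only [Matrix.of_apply, Fin.snoc_last, Fin.snoc_castSucc]
    rw [h5, det_snoc_fin_four] at h4
    have h6 : ∀ p : NonRoot (Bbox n) t → Option (NonRoot (Bbox n) t), Rooted p →
        (∀ j, p (a j) = none) →
        (Matrix.of fun i j => if last p ((Fin.snoc v (a d) : Fin 4 → NonRoot (Bbox n) t) i) = a j
          then (1 : ℝ) else 0).det = - ((-1) ^ (d : ℕ) *
        (Matrix.of fun i j => if last p (v i) = a (d.succAbove j) then (1 : ℝ) else 0).det) := by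
      intro p hr hp
      have h5 : (Matrix.of fun i j => if last p ((Fin.snoc v (a d) :
          Fin 4 → NonRoot (Bbox n) t) i) = a j then (1 : ℝ) else 0)
          = Matrix.of fun i j => (Fin.snoc (fun i j => if last p (v i) = a j then (1 : ℝ) else 0)
            (fun j => if d = j then 1 else 0) : Fin 4 → Fin 4 → ℝ) i j := by
        ext i j
        refine Fin.lastCases ?_ (fun i => ?_) i
        · simp only [Matrix.of_apply, Fin.snoc_last, last_of_none hr (hp d), hinj.eq_iff]
        · simp only [Matrix.of_apply, Fin.snoc_castSucc]
      rw [h5, det_snoc_fin_four, Finset.sum_eq_single d]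
      · simp
      · intro j _ hj
        simp [hj.symm]
      · simp
    rw [Finset.sum_congr rfl fun p hp => h6 p (Finset.mem_filter.1 hp).2.2.1
      (Finset.mem_filter.1 hp).2.2.2, Finset.sum_neg_distrib, ← Finset.mul_sum] at h4
    have h7 : ((-1 : ℝ) ^ (d : ℕ)) * (-1) ^ (d : ℕ) = 1 := by
      rw [← mul_pow]
      simp
    rw [mul_neg, neg_inj] at h4
    have h8 := congrArg (fun y => (-1 : ℝ) ^ (d : ℕ) * y) h4
    simp only [← mul_assoc] at h8
    rw [h7, one_mul] at h8
    rw [h8, Finset.mul_sum]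
    exact Finset.sum_congr rfl fun j _ => by ring
  refine ⟨fun d => L.det * (Matrix.of fun i j => G (v i) (a (d.succAbove j))).det, ?_, ?_, ?_⟩
  · intro d
    simp only [hm]
    refine Finset.sum_nonneg fun p hp => ?_
    obtain ⟨-, hp, hr, -⟩ := Finset.mem_filter.1 hp
    obtain ⟨x, -, -, hx⟩ := minor_eq ht ht' hp hr ha hinj hv hc hc'
    rw [hx]
    split_ifs <;> norm_num
  · simp only [hm]
    rw [Finset.card_filter]
    push_cast
    simp only [Finset.sum_filter]
    rw [Finset.sum_comm]
    refine Finset.sum_congr rfl fun p _ => ?_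
    by_cases hp : (∀ v, p v ∈ boxNeighbors n t v) ∧ Rooted p
    · obtain ⟨hp, hr⟩ := hp
      obtain ⟨x, hxl, hD, hx⟩ := minor_eq ht ht' hp hr ha hinj hv hc hc'
      simp only [hp, hr, hx, hD, true_and, implies_true]
      rw [← sum_missing]
      refine Finset.sum_congr rfl fun d _ => ?_
      by_cases hxd : (x 0 ≠ x 1 ∧ x 0 ≠ x 2 ∧ x 1 ≠ x 2) ∧ ∀ i, x i ≠ d
      · rw [if_pos hxd, if_pos]
        intro j
        obtain ⟨i, hi⟩ := exists_eq_of_ne_missing hxd.1 hxd.2 j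
        rw [← hi, ← hxl]
        exact parent_last hr _
      · rw [if_neg hxd, ite_self]
    · rw [if_neg fun h => hp ⟨h.1, h.2.1⟩, Finset.sum_eq_zero]
      exact fun d _ => if_neg fun h => hp ⟨h.1, h.2.1⟩
  · have h1 : ∑ j : Fin 4, (L.det * (Matrix.of fun i k => G (v i) (a (j.succAbove k))).det) *
        ((-1) ^ (j : ℕ) * ∑ d : Fin 4, (-1) ^ (d : ℕ) * G (a d) (a j)) =
        ∑ d : Fin 4, ∑ j : Fin 4, (-1) ^ (d : ℕ) * (-1) ^ (j : ℕ) * G (a d) (a j) *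
        (L.det * (Matrix.of fun i k => G (v i) (a (j.succAbove k))).det) := by
      rw [Finset.sum_comm]
      refine Finset.sum_congr rfl fun j _ => ?_
      rw [Finset.mul_sum, Finset.mul_sum]
      exact Finset.sum_congr rfl fun d _ => by ring
    rw [h1, ← Finset.sum_congr rfl fun d _ => hm4 d, Finset.sum_comm, Finset.card_filter,
      Finset.sum_filter]
    push_cast
    refine Finset.sum_congr rfl fun p _ => ?_
    by_cases hp : (∀ v, p v ∈ boxNeighbors n t v) ∧ Rooted p ∧ ∀ j, p (a j) = none
    · obtain ⟨x, hxl, hD, hx⟩ := minor_eq ht ht' hp.1 hp.2.1 ha hinj hv hc hc'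
      rw [if_pos hp, Finset.sum_congr rfl fun d _ => hx d, sum_missing]
      simp only [hp, implies_true, hD, true_and, and_true]
    · rw [if_neg hp, if_neg fun h => hp ⟨h.1, h.2.1, h.2.2.2⟩]

end TripodWeights

section TripodExists

/-- A potential on the box which decreases towards the root of an explicit tripod tree. -/
def treeRank (n : ℕ) (t : ℤ × ℤ) (c : Fin 3 → ℤ) (x y : ℤ) : ℕ :=
  if t.2 ≤ y then (y - t.2).natAbs + (x - t.1).natAbs
  else if y = 0 then
    if x ≤ c 0 then (x + n).natAbs + t.2.natAbs + (n + t.1).natAbs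
    else if c 2 ≤ x then (n - x).natAbs + t.2.natAbs + (n - t.1).natAbs
    else t.2.natAbs + (x - t.1).natAbs
  else if x = -n ∨ x = n ∨ x = t.1 then (t.2 - y).natAbs + (x - t.1).natAbs
  else t.2.natAbs + (x - t.1).natAbs + y.natAbs - 2

/-- The branches at the root of an explicit tripod tree. -/
def treeClass (n : ℕ) (t : ℤ × ℤ) (c : Fin 3 → ℤ) (x y : ℤ) : ℕ :=
  if t.2 ≤ y then if x < t.1 then 0 else if t.1 < x then 2 else 3
  else if y = 0 then if x ≤ c 0 then 0 else if c 2 ≤ x then 2 else 1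
  else if x = -n then 0 else if x = n then 2 else 1

section

variable {n : ℕ} {t : ℤ × ℤ} {c : Fin 3 → ℤ} {x y : ℤ}

theorem treeRank_top (h : t.2 ≤ y) :
    treeRank n t c x y = (y - t.2).natAbs + (x - t.1).natAbs := if_pos h

theorem treeRank_bottom_left (h : 0 < t.2) (hx : x ≤ c 0) : treeRank n t c x 0 =
    (x + n).natAbs + t.2.natAbs + (n + t.1).natAbs := by
  rw [treeRank, if_neg h.not_ge, if_pos rfl, if_pos hx]

theorem treeRank_bottom_right (h : 0 < t.2) (hx : c 2 ≤ x) (hc : c 0 < c 2) :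
    treeRank n t c x 0 = (n - x).natAbs + t.2.natAbs + (n - t.1).natAbs := by
  rw [treeRank, if_neg h.not_ge, if_pos rfl, if_neg (hc.trans_le hx).not_ge, if_pos hx]

theorem treeRank_bottom_middle (h : 0 < t.2) (hx : c 0 < x) (hx' : x < c 2) :
    treeRank n t c x 0 = t.2.natAbs + (x - t.1).natAbs := by
  rw [treeRank, if_neg h.not_ge, if_pos rfl, if_neg hx.not_ge, if_neg hx'.not_ge]

theorem treeRank_column (h : y < t.2) (hy : 0 < y) (hx : x = -n ∨ x = n ∨ x = t.1) :
    treeRank n t c x y = (t.2 - y).natAbs + (x - t.1).natAbs := by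
  rw [treeRank, if_neg h.not_ge, if_neg hy.ne', if_pos hx]

theorem treeRank_inner (h : y < t.2) (hy : 0 < y) (hx : ¬ (x = -n ∨ x = n ∨ x = t.1)) :
    treeRank n t c x y = t.2.natAbs + (x - t.1).natAbs + y.natAbs - 2 := by
  rw [treeRank, if_neg h.not_ge, if_neg hy.ne', if_neg hx]

end

set_option maxHeartbeats 1000000 in
theorem exists_tree_step {n : ℕ} {t : ℤ × ℤ} {c : Fin 3 → ℤ} (h1 : 2 ≤ t.2) (h2 : t.2 ≤ 2 * n)
    (h3 : -n < t.1) (h4 : t.1 < n) (h5 : -n < c 0) (h6 : c 0 < c 1) (h7 : c 1 < c 2)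
    (h8 : c 2 < n) (x y : ℤ) (hx : (x, y) ∈ Bbox n) (hxy : ¬ (x = t.1 ∧ y = t.2)) :
    ∃ x' y' i, (x', y') = (x, y) + dir i ∧ (x', y') ∈ Bbox n ∧ (¬ (x' = t.1 ∧ y' = t.2) →
      treeRank n t c x' y' < treeRank n t c x y ∧ treeClass n t c x' y' = treeClass n t c x y) := by
  obtain ⟨t1, t2⟩ := t
  obtain ⟨hx1, hx2, hx3, hx4⟩ := hx
  simp only at h1 h2 h3 h4 hx1 hx2 hx3 hx4 hxy
  generalize hc0 : c 0 = c0 at h5 h6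
  generalize hc1 : c 1 = c1 at h6 h7
  generalize hc2 : c 2 = c2 at h7 h8
  have right : ∀ (_ : x < n), (¬ (x + 1 = t1 ∧ y = t2) →
      treeRank n (t1, t2) c (x + 1) y < treeRank n (t1, t2) c x y ∧
      treeClass n (t1, t2) c (x + 1) y = treeClass n (t1, t2) c x y) →
      ∃ x' y' i, (x', y') = (x, y) + dir i ∧ (x', y') ∈ Bbox n ∧ (¬ (x' = t1 ∧ y' = t2) →
      treeRank n (t1, t2) c x' y' < treeRank n (t1, t2) c x y ∧
      treeClass n (t1, t2) c x' y' = treeClass n (t1, t2) c x y) := fun h h' =>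
    ⟨x + 1, y, 0, by simp [dir], ⟨by simp; omega, by simp; omega, hx3, hx4⟩, h'⟩
  have left : ∀ (_ : -n < x), (¬ (x - 1 = t1 ∧ y = t2) →
      treeRank n (t1, t2) c (x - 1) y < treeRank n (t1, t2) c x y ∧
      treeClass n (t1, t2) c (x - 1) y = treeClass n (t1, t2) c x y) →
      ∃ x' y' i, (x', y') = (x, y) + dir i ∧ (x', y') ∈ Bbox n ∧ (¬ (x' = t1 ∧ y' = t2) →
      treeRank n (t1, t2) c x' y' < treeRank n (t1, t2) c x y ∧
      treeClass n (t1, t2) c x' y' = treeClass n (t1, t2) c x y) := fun h h' =>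
    ⟨x - 1, y, 2, by simp [dir, sub_eq_add_neg], ⟨by simp; omega, by simp; omega, hx3, hx4⟩, h'⟩
  have up : ∀ (_ : y < 2 * n), (¬ (x = t1 ∧ y + 1 = t2) →
      treeRank n (t1, t2) c x (y + 1) < treeRank n (t1, t2) c x y ∧
      treeClass n (t1, t2) c x (y + 1) = treeClass n (t1, t2) c x y) →
      ∃ x' y' i, (x', y') = (x, y) + dir i ∧ (x', y') ∈ Bbox n ∧ (¬ (x' = t1 ∧ y' = t2) →
      treeRank n (t1, t2) c x' y' < treeRank n (t1, t2) c x y ∧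
      treeClass n (t1, t2) c x' y' = treeClass n (t1, t2) c x y) := fun h h' =>
    ⟨x, y + 1, 1, by simp [dir], ⟨hx1, hx2, by simp; omega, by simp; omega⟩, h'⟩
  have down : ∀ (_ : 0 < y), (¬ (x = t1 ∧ y - 1 = t2) →
      treeRank n (t1, t2) c x (y - 1) < treeRank n (t1, t2) c x y ∧
      treeClass n (t1, t2) c x (y - 1) = treeClass n (t1, t2) c x y) →
      ∃ x' y' i, (x', y') = (x, y) + dir i ∧ (x', y') ∈ Bbox n ∧ (¬ (x' = t1 ∧ y' = t2) →
      treeRank n (t1, t2) c x' y' < treeRank n (t1, t2) c x y ∧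
      treeClass n (t1, t2) c x' y' = treeClass n (t1, t2) c x y) := fun h h' =>
    ⟨x, y - 1, 3, by simp [dir, sub_eq_add_neg], ⟨hx1, hx2, by simp; omega, by simp; omega⟩, h'⟩
  rcases lt_trichotomy y t2 with hy | rfl | hy
  · rcases hx3.eq_or_lt with rfl | hy0
    · rcases le_or_gt x c0 with h | h
      · rcases hx1.eq_or_lt with hxn | hxn
        · refine up (by omega) fun _ => ?_
          clear right left up down
          refine ⟨?_, by simp only [treeClass]; split_ifs <;> omega⟩
          rw [treeRank_column (by omega) (by omega) (by omega),
            treeRank_bottom_left hy (by omega)]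
          omega
        · refine left hxn fun _ => ?_
          clear right left up down
          refine ⟨?_, by simp only [treeClass]; split_ifs <;> omega⟩
          rw [treeRank_bottom_left hy (by omega), treeRank_bottom_left hy (by omega)]
          omega
      · rcases le_or_gt c2 x with h' | h'
        · rcases hx2.eq_or_lt with hxn | hxn
          · refine up (by omega) fun _ => ?_
            clear right left up down
            refine ⟨?_, by simp only [treeClass]; split_ifs <;> omega⟩
            rw [treeRank_column (by omega) (by omega) (by omega),
              treeRank_bottom_right hy (by omega) (by omega)]
            omega
          · refine right hxn fun _ => ?_
            clear right left up down
            refine ⟨?_, by simp only [treeClass]; split_ifs <;> omega⟩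
            rw [treeRank_bottom_right hy (by omega) (by omega),
              treeRank_bottom_right hy (by omega) (by omega)]
            omega
        · refine up (by omega) fun _ => ?_
          clear right left up down
          refine ⟨?_, by simp only [treeClass]; split_ifs <;> omega⟩
          rw [treeRank_bottom_middle hy (by omega) (by omega)]
          by_cases hxt : x = t1
          · rw [treeRank_column (by omega) (by omega) (by omega)]
            omega
          · rw [treeRank_inner (by omega) (by omega) (by omega)]
            omega
    · by_cases hxn : x = -n ∨ x = n ∨ x = t1
      · rw [treeRank_column hy hy0 hxn] at up ⊢
        refine up (by omega) fun _ => ?_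
        clear right left up down
        refine ⟨?_, by simp only [treeClass]; split_ifs <;> omega⟩
        rcases lt_or_ge (y + 1) t2 with h | h
        · rw [treeRank_column h (by omega) hxn]
          omega
        · rw [treeRank_top h]
          omega
      · rw [treeRank_inner (x := x) hy hy0 hxn] at right left down ⊢
        rcases eq_or_ne y 1 with rfl | hy1
        · have hr : ∀ z, (z - t1).natAbs < (x - t1).natAbs → treeRank n (t1, t2) c z 1 <
              t2.natAbs + (x - t1).natAbs + Int.natAbs 1 - 2 := by
            intro z hz
            by_cases hzt : z = -n ∨ z = n ∨ z = t1
            · rw [treeRank_column hy hy0 hzt]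
              omega
            · rw [treeRank_inner hy hy0 hzt]
              omega
          rcases lt_or_ge x t1 with h | h
          · refine right (by omega) fun _ => ?_
            clear right left up down
            exact ⟨hr _ (by omega), by simp only [treeClass]; split_ifs <;> omega⟩
          · refine left (by omega) fun _ => ?_
            clear right left up down
            exact ⟨hr _ (by omega), by simp only [treeClass]; split_ifs <;> omega⟩
        · refine down (by omega) fun _ => ?_
          clear right left up down
          refine ⟨?_, by simp only [treeClass]; split_ifs <;> omega⟩
          rw [treeRank_inner (by omega) (by omega) hxn]
          omega
  · rw [treeRank_top (x := x) le_rfl] at right left ⊢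
    rcases lt_or_ge x t1 with h | h
    · refine right (by omega) fun _ => ?_
      clear right left up down
      refine ⟨?_, by simp only [treeClass]; split_ifs <;> omega⟩
      rw [treeRank_top le_rfl]
      omega
    · refine left (by omega) fun _ => ?_
      clear right left up down
      refine ⟨?_, by simp only [treeClass]; split_ifs <;> omega⟩
      rw [treeRank_top le_rfl]
      omega
  · refine down (by omega) fun _ => ?_
    clear right left up down
    refine ⟨?_, by simp only [treeClass]; split_ifs <;> omega⟩
    rw [treeRank_top (by omega), treeRank_top hy.le]
    omega

theorem exists_tripod_tree {n : ℕ} {t : ℤ × ℤ} {c : Fin 3 → ℤ} (h1 : 2 ≤ t.2) (h2 : t.2 ≤ 2 * n)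
    (h3 : -n < t.1) (h4 : t.1 < n) (h5 : -n < c 0) (h6 : c 0 < c 1) (h7 : c 1 < c 2)
    (h8 : c 2 < n) {v : Fin 3 → NonRoot (Bbox n) t} (hv : ∀ i, (v i : ℤ × ℤ) = (c i, 0)) :
    ∃ p : NonRoot (Bbox n) t → Option (NonRoot (Bbox n) t),
      (∀ v, p v ∈ boxNeighbors n t v) ∧ Rooted p ∧ DistinctLast p v := by
  have ht : t ∈ Bbox n := ⟨h3.le, h4.le, by omega, h2⟩
  have step : ∀ x : NonRoot (Bbox n) t, ∃ o : Option (NonRoot (Bbox n) t),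
      o ∈ boxNeighbors n t x ∧ ∀ y, o = some y →
        treeRank n t c y.1.1 y.1.2 < treeRank n t c x.1.1 x.1.2 ∧
        treeClass n t c y.1.1 y.1.2 = treeClass n t c x.1.1 x.1.2 := by
    intro x
    obtain ⟨x', y', i, hi, hB, h⟩ := exists_tree_step h1 h2 h3 h4 h5 h6 h7 h8 x.1.1 x.1.2 x.2.1
      fun h => x.2.2 (Prod.ext h.1 h.2)
    obtain ⟨o, ho⟩ := exists_optVertex (t := t) hB
    refine ⟨o, ?_, ?_⟩
    · rw [mem_boxNeighbors, ho]
      exact Bgraph_adj.2 ⟨x.2.1, hB, i, hi⟩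
    · rintro y rfl
      rw [optVertex_some] at ho
      rw [ho]
      refine h fun h => y.2.2 ?_
      rw [ho]
      exact Prod.ext h.1 h.2
  choose p hp hp' using step
  have hr : Rooted p := Subrelation.wf (r := InvImage (· < ·) fun x : NonRoot (Bbox n) t =>
    treeRank n t c x.1.1 x.1.2) (@fun y x h => (hp' x y h).1) (InvImage.wf _ wellFounded_lt)
  have hcls : ∀ x : NonRoot (Bbox n) t, treeClass n t c (last p x).1.1 (last p x).1.2 =
      treeClass n t c x.1.1 x.1.2 := by
    intro x
    induction x using hr.induction with
    | _ x ih =>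
      rcases hx : p x with _ | y
      · rw [last_of_none hr hx]
      · rw [last_of_some hr hx, ih y hx, (hp' x y hx).2]
  have ne : ∀ i j, treeClass n t c (c i) 0 ≠ treeClass n t c (c j) 0 →
      last p (v i) ≠ last p (v j) := by
    intro i j h hij
    have := hcls (v i)
    rw [hij, hcls (v j), hv i, hv j] at this
    exact h this.symm
  refine ⟨p, hp, hr, ne _ _ ?_, ne _ _ ?_, ne _ _ ?_⟩ <;>
  · simp only [treeClass]
    split_ifs <;> omega

end TripodExists

section LatticeKernel

open Real

/-- The total difference of `f` over the four lattice neighbours of `x`. -/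
def latticeLaplacian (f : ℤ × ℤ → ℝ) (x : ℤ × ℤ) : ℝ := ∑ i, (f x - f (x + dir i))

/-- The source putting alternating charges on the four neighbours of the origin. -/
def quadrupole (x : ℤ × ℤ) : ℝ := ∑ i : Fin 4, if x = dir i then (-1 : ℝ) ^ (i : ℕ) else 0

/-- The vertical profile, at height `k`, of the horizontal Fourier mode of frequency `2φ` of the
potential of the quadrupole. -/
noncomputable def kernelMode (k : ℕ) (φ : ℝ) : ℝ :=
  (if k = 0 then 1 else 0) -
    2 * (sin φ / √(1 + sin φ ^ 2)) * ((√(1 + sin φ ^ 2) - sin φ) ^ 2) ^ k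

/-- The potential of the quadrupole in the square lattice, as a Fourier integral. -/
noncomputable def quadrupolePotential (x : ℤ × ℤ) : ℝ :=
  2 / π * ∫ φ in (0 : ℝ)..(π / 2), cos (2 * x.1 * φ) * kernelMode x.2.natAbs φ

theorem continuous_kernelMode (k : ℕ) : Continuous (kernelMode k) := by
  unfold kernelMode
  have : ∀ φ, √(1 + sin φ ^ 2) ≠ 0 := fun φ => by positivity
  fun_prop (disch := exact this _)

theorem integral_cos_even_mul (k : ℤ) :
    ∫ φ in (0 : ℝ)..(π / 2), cos (2 * k * φ) = if k = 0 then π / 2 else 0 := by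
  split_ifs with h
  · simp [h]
  · have h' : (2 * k : ℝ) ≠ 0 := by simpa using h
    rw [intervalIntegral.integral_comp_mul_left (fun x => cos x) h', integral_cos]
    rw [show 2 * (k : ℝ) * (π / 2) = k * π by ring, sin_int_mul_pi]
    simp

theorem kernelMode_equation (b : ℤ) (φ : ℝ) :
    (4 - 2 * cos (2 * φ)) * kernelMode b.natAbs φ - kernelMode (b + 1).natAbs φ -
      kernelMode (b - 1).natAbs φ =
      if b = 0 then 2 * cos (2 * φ) else if b = 1 ∨ b = -1 then -1 else 0 := by
  have hA : √(1 + sin φ ^ 2) ^ 2 = 1 + sin φ ^ 2 := sq_sqrt (by positivity)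
  have hA0 : √(1 + sin φ ^ 2) ≠ 0 := by positivity
  have hc : cos (2 * φ) = 1 - 2 * sin φ ^ 2 := by rw [cos_two_mul, cos_sq']; ring
  unfold kernelMode
  rw [hc]
  set s := sin φ
  set A := √(1 + s ^ 2)
  have hS : s / A * A = s := div_mul_cancel₀ _ hA0
  set S := s / A
  have hr : (A - s) ^ 2 * (A - s) ^ 2 = (2 + 4 * s ^ 2) * (A - s) ^ 2 - 1 := by
    linear_combination (A ^ 2 - 4 * A * s + 3 * s ^ 2 - 1) * hA
  have hrS : (A - s) ^ 2 * S = (1 + 2 * s ^ 2) * S - 2 * s ^ 2 := by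
    linear_combination S * hA - 2 * s * hS
  set r := (A - s) ^ 2
  have key : ∀ k : ℕ, (2 + 4 * s ^ 2) * r ^ (k + 1) = r ^ (k + 2) + r ^ k := fun k => by
    linear_combination -r ^ k * hr
  have pos : ∀ k : ℕ, (4 - 2 * (1 - 2 * s ^ 2)) * (0 - 2 * S * r ^ (k + 2)) -
      (0 - 2 * S * r ^ (k + 3)) - (0 - 2 * S * r ^ (k + 1)) = 0 := fun k => by
    linear_combination (-2 * S) * key (k + 1)
  have one : (4 - 2 * (1 - 2 * s ^ 2)) * (0 - 2 * S * r ^ 1) - (0 - 2 * S * r ^ 2) -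
      (1 - 2 * S * r ^ 0) = -1 := by
    linear_combination (-2 * S) * key 0
  rcases lt_trichotomy b 0 with h | rfl | h
  · obtain ⟨k, rfl⟩ : ∃ k : ℕ, b = -((k : ℤ) + 1) := ⟨(-b - 1).toNat, by omega⟩
    rw [show (-((k : ℤ) + 1)).natAbs = k + 1 by omega,
      show (-((k : ℤ) + 1) + 1).natAbs = k by omega,
      show (-((k : ℤ) + 1) - 1).natAbs = k + 2 by omega]
    rcases k with _ | k
    · rw [sub_right_comm]
      simpa using one
    · rw [if_neg (by omega), if_neg (by omega), if_neg (by omega), if_neg (by omega),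
        if_neg (by omega)]
      linear_combination pos k
  · simp only [Int.natAbs_zero, zero_add, zero_sub, Int.natAbs_neg, Int.natAbs_one, if_true,
      one_ne_zero, if_false, pow_zero, pow_one, mul_one]
    linear_combination 4 * hrS
  · obtain ⟨k, rfl⟩ : ∃ k : ℕ, b = (k : ℤ) + 1 := ⟨(b - 1).toNat, by omega⟩
    rw [show ((k : ℤ) + 1).natAbs = k + 1 by omega,
      show ((k : ℤ) + 1 + 1).natAbs = k + 2 by omega,
      show ((k : ℤ) + 1 - 1).natAbs = k by omega]
    rcases k with _ | k
    · simpa using one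
    · rw [if_neg (by omega), if_neg (by omega), if_neg (by omega), if_neg (by omega),
        if_neg (by omega)]
      linear_combination pos k

theorem latticeLaplacian_quadrupolePotential (x : ℤ × ℤ) :
    latticeLaplacian quadrupolePotential x = quadrupole x := by
  obtain ⟨a, b⟩ := x
  have hint : ∀ (k : ℤ) (j : ℕ), IntervalIntegrable (fun φ => cos (2 * k * φ) * kernelMode j φ)
      MeasureTheory.volume 0 (π / 2) := fun k j =>
    ((by fun_prop : Continuous fun φ : ℝ => cos (2 * k * φ)).mul
      (continuous_kernelMode j)).intervalIntegrable _ _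
  have hcos : ∀ k : ℤ, IntervalIntegrable (fun φ => cos (2 * k * φ))
      MeasureTheory.volume 0 (π / 2) := fun k =>
    (by fun_prop : Continuous fun φ : ℝ => cos (2 * k * φ)).intervalIntegrable _ _
  have h1 : latticeLaplacian quadrupolePotential (a, b) = 2 / π *
      ∫ φ in (0 : ℝ)..(π / 2), cos (2 * a * φ) *
        ((4 - 2 * cos (2 * φ)) * kernelMode b.natAbs φ - kernelMode (b + 1).natAbs φ -
          kernelMode (b - 1).natAbs φ) := by
    have e : ∀ φ : ℝ, cos (2 * a * φ) *
        ((4 - 2 * cos (2 * φ)) * kernelMode b.natAbs φ - kernelMode (b + 1).natAbs φ -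
          kernelMode (b - 1).natAbs φ) =
        4 * (cos (2 * a * φ) * kernelMode b.natAbs φ) -
        cos (2 * (a + 1 : ℤ) * φ) * kernelMode b.natAbs φ -
        cos (2 * (a - 1 : ℤ) * φ) * kernelMode b.natAbs φ -
        cos (2 * a * φ) * kernelMode (b + 1).natAbs φ -
        cos (2 * a * φ) * kernelMode (b - 1).natAbs φ := fun φ => by
      have : 2 * cos (2 * a * φ) * cos (2 * φ) =
          cos (2 * (a + 1 : ℤ) * φ) + cos (2 * (a - 1 : ℤ) * φ) := by
        push_cast
        rw [show 2 * ((a : ℝ) + 1) * φ = 2 * a * φ + 2 * φ by ring,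
          show 2 * ((a : ℝ) - 1) * φ = 2 * a * φ - 2 * φ by ring, cos_add, cos_sub]
        ring
      linear_combination -kernelMode b.natAbs φ * this
    simp only [e]
    rw [intervalIntegral.integral_sub (((((hint a _).const_mul 4).sub (hint _ _)).sub
        (hint _ _)).sub (hint _ _)) (hint _ _),
      intervalIntegral.integral_sub ((((hint a _).const_mul 4).sub (hint _ _)).sub
        (hint _ _)) (hint _ _),
      intervalIntegral.integral_sub (((hint a _).const_mul 4).sub (hint _ _)) (hint _ _),
      intervalIntegral.integral_sub ((hint a _).const_mul 4) (hint _ _),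
      intervalIntegral.integral_const_mul]
    simp only [latticeLaplacian, Fin.sum_univ_four, dir, quadrupolePotential]
    simp [← sub_eq_add_neg]
    ring
  rw [h1]
  simp only [kernelMode_equation]
  by_cases hb : b = 0
  · subst hb
    have e : ∀ φ : ℝ, cos (2 * a * φ) * (2 * cos (2 * φ)) =
        cos (2 * (a + 1 : ℤ) * φ) + cos (2 * (a - 1 : ℤ) * φ) := fun φ => by
      push_cast
      rw [show 2 * ((a : ℝ) + 1) * φ = 2 * a * φ + 2 * φ by ring,
        show 2 * ((a : ℝ) - 1) * φ = 2 * a * φ - 2 * φ by ring, cos_add, cos_sub]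
      ring
    simp only [if_true, e]
    rw [intervalIntegral.integral_add (hcos _) (hcos _), integral_cos_even_mul,
      integral_cos_even_mul]
    have : a + 1 = 0 ↔ a = -1 := by omega
    have h' : a - 1 = 0 ↔ a = 1 := by omega
    simp only [quadrupole, Fin.sum_univ_four, dir, this, h']
    by_cases h1 : a = 1
    · simp [h1]
    · by_cases h2 : a = -1
      · simp [h2]
      · simp [h1, h2]
  · simp only [if_neg hb]
    by_cases hb' : b = 1 ∨ b = -1
    · simp only [if_pos hb', intervalIntegral.integral_mul_const, integral_cos_even_mul]
      simp only [quadrupole, Fin.sum_univ_four, dir]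
      by_cases ha : a = 0
      · rcases hb' with rfl | rfl
        · simp [ha]
        · simp [ha]
          norm_num
      · simp [ha, hb]
    · simp only [if_neg hb', quadrupole, Fin.sum_univ_four, dir]
      push Not at hb'
      simp [hb, hb'.1, hb'.2]

theorem integral_sin_div_sqrt :
    ∫ φ in (0 : ℝ)..(π / 2), sin φ / √(1 + sin φ ^ 2) = π / 4 := by
  have h : ∀ φ ∈ Set.uIcc 0 (π / 2),
      HasDerivAt (fun φ => -arcsin (cos φ / √2)) (sin φ / √(1 + sin φ ^ 2)) φ := by
    intro φ _
    have h2 : (0 : ℝ) < √2 := by positivity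
    have hs : √2 ^ 2 = 2 := sq_sqrt (by norm_num)
    have hlt : (cos φ / √2) ^ 2 < 1 := by
      rw [div_pow, hs]
      nlinarith [cos_sq_le_one φ]
    have hlt' := abs_lt.1 ((sq_lt_one_iff_abs_lt_one _).1 hlt)
    have hd := ((hasDerivAt_arcsin hlt'.1.ne' hlt'.2.ne).comp φ
      ((hasDerivAt_cos φ).div_const √2)).neg
    refine hd.congr_deriv ?_
    have e : √(1 + sin φ ^ 2) = √2 * √(1 - (cos φ / √2) ^ 2) := by
      rw [← sqrt_mul (by norm_num)]
      congr 1
      rw [div_pow, hs, sin_sq]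
      ring
    have : √(1 - (cos φ / √2) ^ 2) ≠ 0 := (sqrt_pos.2 (by linarith)).ne'
    rw [e]
    field_simp
  rw [intervalIntegral.integral_eq_sub_of_hasDerivAt h]
  · have : arcsin (√2)⁻¹ = π / 4 := by
      rw [← Real.sqrt_div_self, ← sin_pi_div_four, arcsin_sin] <;> linarith [pi_pos]
    simp [this]
  · refine Continuous.intervalIntegrable ?_ _ _
    have : ∀ φ, √(1 + sin φ ^ 2) ≠ 0 := fun φ => by positivity
    fun_prop (disch := exact this _)

theorem quadrupolePotential_zero : quadrupolePotential 0 = 0 := by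
  have hc : Continuous fun φ => sin φ / √(1 + sin φ ^ 2) := by
    have : ∀ φ, √(1 + sin φ ^ 2) ≠ 0 := fun φ => by positivity
    fun_prop (disch := exact this _)
  have : ∫ φ in (0 : ℝ)..(π / 2), (1 - 2 * (sin φ / √(1 + sin φ ^ 2))) = 0 := by
    rw [intervalIntegral.integral_sub (by simp) ((hc.const_mul 2).intervalIntegrable _ _),
      intervalIntegral.integral_const_mul, integral_sin_div_sqrt]
    simp
    ring
  simp [quadrupolePotential, kernelMode, this]

theorem quadrupolePotential_vertical (b : ℤ) (hb : b.natAbs = 1) :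
    quadrupolePotential (0, b) = -(4 / π - 1) := by
  have hc : Continuous fun φ => sin φ / √(1 + sin φ ^ 2) := by
    have : ∀ φ, √(1 + sin φ ^ 2) ≠ 0 := fun φ => by positivity
    fun_prop (disch := exact this _)
  have hpos : ∀ φ, √(1 + sin φ ^ 2) ≠ 0 := fun φ => by positivity
  have hsq : ∀ φ, √(1 + sin φ ^ 2) ^ 2 = 1 + sin φ ^ 2 := fun φ => sq_sqrt (by positivity)
  set D : ℝ → ℝ := fun φ =>
    sin φ * √(1 + sin φ ^ 2) - cos φ * (sin φ * cos φ / √(1 + sin φ ^ 2)) with hD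
  have hDc : Continuous D := by
    fun_prop (disch := exact hpos _)
  have hDi : ∫ φ in (0 : ℝ)..(π / 2), D φ = 1 := by
    have h : ∀ φ ∈ Set.uIcc 0 (π / 2), HasDerivAt (fun φ => -cos φ * √(1 + sin φ ^ 2)) (D φ) φ := by
      intro φ _
      have h1 := (((hasDerivAt_sin φ).fun_pow 2).const_add 1).sqrt (by positivity)
      refine ((hasDerivAt_cos φ).neg.mul h1).congr_deriv ?_
      simp only [hD]
      have := hpos φ
      field_simp
      norm_num
      ring
    rw [intervalIntegral.integral_eq_sub_of_hasDerivAt h (hDc.intervalIntegrable _ _)]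
    simp
  have e : ∀ φ, kernelMode 1 φ = 4 * sin φ ^ 2 - 2 * D φ - 2 * (sin φ / √(1 + sin φ ^ 2)) := by
    intro φ
    have h := hpos φ
    have h' := hsq φ
    have hcs := sin_sq_add_cos_sq φ
    simp only [kernelMode, hD]
    set A := √(1 + sin φ ^ 2)
    set s := sin φ
    have hcs' : cos φ ^ 2 = 1 - s ^ 2 := by linarith
    field_simp
    simp only [one_ne_zero, if_false, hcs']
    linear_combination (0 : ℝ) * h'
  have hs : Continuous fun φ => sin φ ^ 2 := by fun_prop
  have : ∫ φ in (0 : ℝ)..(π / 2), kernelMode 1 φ = π / 2 - 2 := by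
    simp only [e]
    rw [intervalIntegral.integral_sub (f := fun φ => 4 * sin φ ^ 2 - 2 * D φ) (((hs.const_mul 4).sub
        (hDc.const_mul 2)).intervalIntegrable _ _) ((hc.const_mul 2).intervalIntegrable _ _),
      intervalIntegral.integral_sub ((hs.const_mul 4).intervalIntegrable _ _)
        ((hDc.const_mul 2).intervalIntegrable _ _),
      intervalIntegral.integral_const_mul, intervalIntegral.integral_const_mul,
      intervalIntegral.integral_const_mul, integral_sin_div_sqrt, hDi, integral_sin_sq]
    simp
    ring
  simp only [quadrupolePotential, hb, Int.cast_zero, mul_zero, zero_mul, cos_zero, one_mul, this]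
  field_simp
  ring

theorem quadrupolePotential_dir (j : Fin 4) :
    (-1) ^ (j : ℕ) * quadrupolePotential (dir j) = 4 / π - 1 := by
  have h0 := latticeLaplacian_quadrupolePotential 0
  have heven : quadrupolePotential (-1, 0) = quadrupolePotential (1, 0) := by
    simp [quadrupolePotential]
  simp only [latticeLaplacian, quadrupolePotential_zero, zero_add, quadrupole,
    Fin.sum_univ_four, dir] at h0
  simp [heven, quadrupolePotential_vertical 1 rfl, quadrupolePotential_vertical (-1) rfl,
    Prod.ext_iff] at h0
  fin_cases j <;>
    simp [dir, heven, quadrupolePotential_vertical 1 rfl, quadrupolePotential_vertical (-1) rfl] <;>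
    linarith

open Filter Topology

theorem abs_quadrupolePotential_le (x : ℤ × ℤ) (hx : x.2 ≠ 0) :
    |quadrupolePotential x| ≤ 1 / x.2.natAbs := by
  have hk : x.2.natAbs ≠ 0 := by simpa using hx
  set k := x.2.natAbs
  have hk' : (0 : ℝ) < k := by positivity
  have hb : ∀ φ ∈ Set.uIoc (0 : ℝ) (π / 2), ‖cos (2 * x.1 * φ) * kernelMode k φ‖ ≤ 1 / k := by
    intro φ hφ
    rw [Set.uIoc_of_le (by positivity)] at hφ
    have hs : 0 ≤ sin φ := sin_nonneg_of_nonneg_of_le_pi hφ.1.le (by linarith [hφ.2, pi_pos])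
    have hA : √(1 + sin φ ^ 2) ^ 2 = 1 + sin φ ^ 2 := sq_sqrt (by positivity)
    have hA1 : 1 ≤ √(1 + sin φ ^ 2) := one_le_sqrt.2 (by nlinarith)
    rw [norm_mul]
    have h1 : ‖kernelMode k φ‖ ≤ 1 / k := by
      simp only [kernelMode, if_neg hk, zero_sub, norm_neg]
      set A := √(1 + sin φ ^ 2)
      set s := sin φ
      have hAs : 0 < A - s := by nlinarith
      have hmul : (A - s) * (A + s) = 1 := by linear_combination hA
      have h2 : (A - s) ^ 2 = ((A + s) ^ 2)⁻¹ := by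
        rw [← inv_pow]; congr 1
        exact eq_inv_of_mul_eq_one_left hmul
      have hbern : 1 + (k : ℝ) * (2 * s) ≤ ((A + s) ^ 2) ^ k := by
        refine (one_add_mul_le_pow (by linarith) k).trans ?_
        gcongr
        nlinarith
      rw [norm_of_nonneg (by positivity), h2, inv_pow]
      have h3 : s / A ≤ s := div_le_self hs hA1
      have h4 : (((A + s) ^ 2) ^ k)⁻¹ ≤ (1 + (k : ℝ) * (2 * s))⁻¹ := by
        gcongr
      calc 2 * (s / A) * (((A + s) ^ 2) ^ k)⁻¹ ≤ 2 * s * (1 + (k : ℝ) * (2 * s))⁻¹ := by gcongr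
        _ ≤ 1 / k := by
          rw [← div_eq_mul_inv, div_le_div_iff₀ (by positivity) hk']
          linarith
    calc _ ≤ 1 * (1 / (k : ℝ)) := by
          gcongr
          exact abs_cos_le_one _
      _ = _ := one_mul _
  have := intervalIntegral.norm_integral_le_of_norm_le_const hb
  rw [quadrupolePotential, abs_mul, abs_of_pos (by positivity)]
  rw [sub_zero, abs_of_pos (by positivity)] at this
  calc _ ≤ 2 / π * (1 / k * (π / 2)) := by gcongr; exact this
    _ = 1 / k := by field_simp

theorem tendsto_quadrupolePotential_row (b : ℤ) :
    Tendsto (fun a : ℤ => quadrupolePotential (a, b)) cofinite (𝓝 0) := by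
  let f : ℝ → ℂ := (Set.Ioc 0 (π / 2)).indicator fun φ => (kernelMode b.natAbs φ : ℂ)
  have h := Real.tendsto_integral_exp_smul_cocompact f
  have hlim : Tendsto (fun a : ℤ => (a : ℝ) / π) cofinite (cocompact ℝ) := by
    refine Tendsto.comp (g := fun x : ℝ => x / π) ?_ Int.tendsto_coe_cofinite
    exact (Homeomorph.mulRight₀ π⁻¹ (by positivity)).isClosedEmbedding.tendsto_cocompact
  have h' := (Complex.continuous_re.tendsto 0).comp (h.comp hlim)
  rw [Complex.zero_re] at h'
  have := h'.const_mul (2 / π)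
  rw [mul_zero] at this
  refine this.congr fun a => ?_
  simp only [quadrupolePotential, Function.comp]
  congr 1
  have e : ∀ v : ℝ, (fourierChar (-(v * (a / π))) : ℂ) • f v = (Set.Ioc 0 (π / 2)).indicator
      (fun φ => Complex.exp ((-(2 * a * φ) : ℝ) * Complex.I) * (kernelMode b.natAbs φ : ℂ)) v := by
    intro v
    by_cases hv : v ∈ Set.Ioc 0 (π / 2)
    · simp only [f, Set.indicator_of_mem hv, Real.fourierChar_apply, smul_eq_mul]
      congr 3
      push_cast
      field_simp
    · simp only [f, Set.indicator_of_notMem hv, smul_zero]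
  have e' : ∫ v : ℝ, (fourierChar (-(v * (a / π))) : ℂ) • f v = ∫ φ in (0:ℝ)..(π / 2),
      Complex.exp ((-(2 * a * φ) : ℝ) * Complex.I) * (kernelMode b.natAbs φ : ℂ) := by
    simp only [e]
    rw [MeasureTheory.integral_indicator measurableSet_Ioc,
      intervalIntegral.integral_of_le (by positivity)]
  refine (congrArg Complex.re e').trans ?_
  have hi : IntervalIntegrable (fun φ : ℝ =>
      Complex.exp ((-(2 * a * φ) : ℝ) * Complex.I) * (kernelMode b.natAbs φ : ℂ))
      MeasureTheory.volume 0 (π / 2) := by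
    refine Continuous.intervalIntegrable ?_ _ _
    have := continuous_kernelMode b.natAbs
    fun_prop
  have hre := Complex.reCLM.intervalIntegral_comp_comm hi
  rw [Complex.reCLM_apply] at hre
  rw [← hre]
  congr 1
  ext φ
  rw [Complex.reCLM_apply, Complex.re_mul_ofReal, Complex.exp_ofReal_mul_I_re, cos_neg]

theorem tendsto_quadrupolePotential : Tendsto quadrupolePotential cofinite (𝓝 0) := by
  rw [Metric.tendsto_nhds]
  intro ε hε
  obtain ⟨M, hM⟩ := exists_nat_gt (1 / ε)
  have hM0 : (0 : ℝ) < M := (by positivity : (0 : ℝ) < 1 / ε).trans hM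
  have hrow : ∀ b : ℤ, {a : ℤ | ¬ dist (quadrupolePotential (a, b)) 0 < ε}.Finite := fun b =>
    (Metric.tendsto_nhds.1 (tendsto_quadrupolePotential_row b)) ε hε
  rw [eventually_cofinite]
  refine ((Set.finite_Icc (-M : ℤ) M).biUnion fun b _ =>
    (hrow b).image fun a => (a, b)).subset ?_
  rintro ⟨a, b⟩ h
  simp only [Set.mem_iUnion]
  refine ⟨b, ?_, a, h, rfl⟩
  by_contra hb
  have hb' : M < b.natAbs := by
    rw [Set.mem_Icc] at hb
    omega
  refine h ?_
  rw [Real.dist_eq, sub_zero]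
  refine (abs_quadrupolePotential_le (a, b) (by simp only; omega)).trans_lt ?_
  rw [one_div_lt (hM0.trans (by exact_mod_cast hb')) hε]
  exact hM.trans (by exact_mod_cast hb')

end LatticeKernel

section LatticeLimit

open Filter Topology

theorem lattice_induction {P : ℤ × ℤ → Prop} (zero : P 0) (step : ∀ x i, P x → P (x + dir i))
    (x : ℤ × ℤ) : P x := by
  obtain ⟨a, b⟩ := x
  have h1 : P (a, 0) := by
    induction a using Int.induction_on with
    | zero => exact zero
    | succ k ih => simpa [dir] using step _ 0 ih
    | pred k ih => simpa [dir, sub_eq_add_neg] using step _ 2 ih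
  induction b using Int.induction_on with
  | zero => exact h1
  | succ k ih => simpa [dir] using step _ 1 ih
  | pred k ih => simpa [dir, sub_eq_add_neg] using step _ 3 ih

theorem nonpos_of_harmonic {g : ℤ × ℤ → ℝ} (hg : ∀ x, latticeLaplacian g x = 0)
    (h0 : Tendsto g cofinite (𝓝 0)) (x : ℤ × ℤ) : g x ≤ 0 := by
  by_contra! hx
  have hfin : {y | g x ≤ g y}.Finite := by
    have := h0.eventually_lt_const hx
    rw [eventually_cofinite] at this
    simpa using this
  obtain ⟨y, hy, hmax⟩ := Set.exists_max_image _ g hfin ⟨x, le_refl (g x)⟩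
  have hle : ∀ z, g z ≤ g y := fun z => by
    by_cases hz : g x ≤ g z
    · exact hmax z hz
    · exact (not_le.1 hz).le.trans hy
  obtain ⟨z, hz, hzmax⟩ := Set.exists_max_image {z | g z = g y} Prod.fst
    (hfin.subset fun z (hz : g z = g y) => hy.trans_eq hz.symm) ⟨y, rfl⟩
  have hzy : g z = g y := hz
  have hz0 := hg z
  rw [latticeLaplacian, Finset.sum_eq_zero_iff_of_nonneg fun i _ =>
    sub_nonneg.2 ((hle _).trans_eq hzy.symm)] at hz0
  have h1 := hzmax (z + dir 0) ((sub_eq_zero.1 (hz0 0 (Finset.mem_univ _))).symm.trans hzy)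
  simp [dir] at h1

theorem eq_zero_of_harmonic {g : ℤ × ℤ → ℝ} (hg : ∀ x, latticeLaplacian g x = 0)
    (h0 : Tendsto g cofinite (𝓝 0)) (x : ℤ × ℤ) : g x = 0 := by
  refine le_antisymm (nonpos_of_harmonic hg h0 x) ?_
  have := nonpos_of_harmonic (g := fun x => -g x) (fun x => ?_) (by simpa using h0.neg) x
  · linarith
  · have := hg x
    simp only [latticeLaplacian, sub_neg_eq_add] at this ⊢
    rw [← neg_eq_zero, ← Finset.sum_neg_distrib, ← this]
    exact Finset.sum_congr rfl fun i _ => by ring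

theorem tendsto_cofinite_add_dir {f : ℤ × ℤ → ℝ} (h : Tendsto f cofinite (𝓝 0)) (i : Fin 4) :
    Tendsto (fun x => f (x + dir i)) cofinite (𝓝 0) :=
  h.comp (add_left_injective (dir i)).tendsto_cofinite

theorem eq_quadrupolePotential {h : ℤ × ℤ → ℝ} (h0 : h 0 = 0)
    (hl : ∀ x, latticeLaplacian h x = quadrupole x)
    (hd : ∀ i, Tendsto (fun x => h (x + dir i) - h x) cofinite (𝓝 0)) (x : ℤ × ℤ) :
    h x = quadrupolePotential x := by
  set w : ℤ × ℤ → ℝ := fun x => h x - quadrupolePotential x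
  have hw : ∀ x, latticeLaplacian w x = 0 := fun x => by
    have h1 := hl x
    rw [← latticeLaplacian_quadrupolePotential, ← sub_eq_zero] at h1
    rw [← h1]
    simp only [latticeLaplacian, w, ← Finset.sum_sub_distrib]
    exact Finset.sum_congr rfl fun i _ => by ring
  have hstep : ∀ i x, w (x + dir i) - w x = 0 := fun i =>
    eq_zero_of_harmonic (fun x => by
      have h1 := hw (x + dir i)
      have h2 := hw x
      rw [← sub_eq_zero.2 (h1.trans h2.symm)]
      simp only [latticeLaplacian, ← Finset.sum_sub_distrib]
      exact Finset.sum_congr rfl fun j _ => by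
        rw [add_right_comm x (dir j) (dir i)]; ring)
      (by
        have := (hd i).sub ((tendsto_cofinite_add_dir tendsto_quadrupolePotential i).sub
          tendsto_quadrupolePotential)
        simp only [sub_zero] at this
        exact this.congr fun x => by simp only [w]; ring)
  have hw0 : w x = 0 := lattice_induction (P := fun x => w x = 0)
    (by simp [w, h0, quadrupolePotential_zero]) (fun x i hx => by linarith [hstep i x]) x
  exact sub_eq_zero.1 hw0

theorem tendsto_of_energy_le {F : ℕ → ℤ × ℤ → ℝ} {C : ℝ} (h0 : ∀ᶠ n in atTop, F n 0 = 0)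
    (hl : ∀ x, ∀ᶠ n in atTop, latticeLaplacian (F n) x = quadrupole x)
    (hE : ∀ K : Finset (ℤ × ℤ), ∀ᶠ n in atTop,
      ∑ x ∈ K, ∑ i, (F n (x + dir i) - F n x) ^ 2 ≤ C) (x : ℤ × ℤ) :
    Tendsto (fun n => F n x) atTop (𝓝 (quadrupolePotential x)) := by
  rw [tendsto_iff_ultrafilter]
  intro U hU
  have hdiff : ∀ x i, ∃ l, Tendsto (fun n => F n (x + dir i) - F n x) U (𝓝 l) := by
    intro x i
    have hb : ∀ᶠ n in U, F n (x + dir i) - F n x ∈ Set.Icc (-(C + 1)) (C + 1) := by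
      filter_upwards [hU (hE {x})] with n hn
      rw [Finset.sum_singleton] at hn
      have h1 := (Finset.single_le_sum (f := fun i => (F n (x + dir i) - F n x) ^ 2)
        (fun j _ => sq_nonneg _) (Finset.mem_univ i)).trans hn
      constructor <;> nlinarith
    obtain ⟨l, -, hl⟩ := isCompact_Icc.ultrafilter_le_nhds
      (U.map fun n => F n (x + dir i) - F n x) (le_principal_iff.2 hb)
    exact ⟨l, hl⟩
  have hlim : ∀ x, ∃ l, Tendsto (fun n => F n x) U (𝓝 l) := by
    refine lattice_induction ⟨0, ?_⟩ ?_
    · exact tendsto_const_nhds.congr' ((h0.filter_mono hU).mono fun n hn => hn.symm)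
    · rintro x i ⟨l, hl⟩
      obtain ⟨l', hl'⟩ := hdiff x i
      exact ⟨l + l', (hl.add hl').congr fun n => by ring⟩
  choose h hh using hlim
  have hh0 : h 0 = 0 := tendsto_nhds_unique (hh 0)
    (tendsto_const_nhds.congr' ((h0.filter_mono hU).mono fun n hn => hn.symm))
  have hhl : ∀ x, latticeLaplacian h x = quadrupole x := fun x =>
    tendsto_nhds_unique
      (f := fun n => latticeLaplacian (F n) x)
      (tendsto_finsetSum _ fun i _ => (hh x).sub (hh (x + dir i)))
      (tendsto_const_nhds.congr' (((hl x).filter_mono hU).mono fun n hn => hn.symm))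
  have hhE : ∀ K : Finset (ℤ × ℤ), ∑ x ∈ K, ∑ i, (h (x + dir i) - h x) ^ 2 ≤ C := fun K =>
    le_of_tendsto (f := fun n => ∑ x ∈ K, ∑ i, (F n (x + dir i) - F n x) ^ 2)
      (tendsto_finsetSum _ fun x _ => tendsto_finsetSum _ fun i _ =>
        ((hh (x + dir i)).sub (hh x)).pow 2) (hU (hE K))
  have hs := (summable_of_sum_le (fun x => Finset.sum_nonneg fun i _ => sq_nonneg _)
    hhE).tendsto_cofinite_zero
  rw [← eq_quadrupolePotential hh0 hhl (fun i => ?_) x]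
  · exact hh x
  · have h1 : Tendsto (fun x => (h (x + dir i) - h x) ^ 2) cofinite (𝓝 0) :=
      squeeze_zero (fun x => sq_nonneg _) (fun x =>
        Finset.single_le_sum (f := fun i => (h (x + dir i) - h x) ^ 2)
          (fun j _ => sq_nonneg _) (Finset.mem_univ i)) hs
    have h2 := h1.sqrt
    simp only [Real.sqrt_sq_eq_abs, Real.sqrt_zero] at h2
    exact (tendsto_zero_iff_abs_tendsto_zero _).2 h2

end LatticeLimit

section GroundedPotential

variable {n : ℕ} {t : ℤ × ℤ}

/-- The box `Bbox n` as a finset. -/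
noncomputable def boxFinset (n : ℕ) : Finset (ℤ × ℤ) := (Bbox_finite n).toFinset

theorem mem_boxFinset {x : ℤ × ℤ} : x ∈ boxFinset n ↔ x ∈ Bbox n :=
  (Bbox_finite n).mem_toFinset

open Classical in
/-- The neighbours of a vertex in the grid graph. -/
noncomputable def gridNeighbors (n : ℕ) (x : ℤ × ℤ) : Finset (ℤ × ℤ) :=
  (boxFinset n).filter ((Bgraph n).Adj x)

theorem mem_gridNeighbors {x y : ℤ × ℤ} : y ∈ gridNeighbors n x ↔ (Bgraph n).Adj x y := by
  simp only [gridNeighbors, Finset.mem_filter, mem_boxFinset]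
  exact ⟨fun h => h.2, fun h => ⟨(Bgraph_adj.1 h).2.1, h⟩⟩

theorem dir_injective : Function.Injective dir := by decide

theorem sum_gridNeighbors_interior {x : ℤ × ℤ} (hx : x ∈ Bbox n) (hx' : ∀ i, x + dir i ∈ Bbox n)
    (φ : ℤ × ℤ → ℝ) : ∑ y ∈ gridNeighbors n x, φ y = ∑ i, φ (x + dir i) := by
  have : gridNeighbors n x = Finset.univ.image fun i => x + dir i := by
    ext y
    rw [mem_gridNeighbors, Bgraph_adj, Finset.mem_image]
    constructor
    · rintro ⟨-, -, i, rfl⟩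
      exact ⟨i, Finset.mem_univ _, rfl⟩
    · rintro ⟨i, -, rfl⟩
      exact ⟨hx, hx' i, i, rfl⟩
  rw [this, Finset.sum_image fun i _ j _ hij => dir_injective (add_left_cancel hij)]

theorem sum_boxNeighbors (x : NonRoot (Bbox n) t) (φ : ℤ × ℤ → ℝ) :
    ∑ o ∈ boxNeighbors n t x, φ (optVertex o) = ∑ y ∈ gridNeighbors n x, φ y := by
  refine Finset.sum_nbij optVertex ?_ optVertex_injective.injOn ?_ fun _ _ => rfl
  · intro o ho
    exact mem_gridNeighbors.2 (mem_boxNeighbors.1 ho)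
  · intro y hy
    rw [Finset.mem_coe, mem_gridNeighbors] at hy
    obtain ⟨o, rfl⟩ := exists_optVertex (t := t) (Bgraph_adj.1 hy).2.1
    exact ⟨o, mem_boxNeighbors.2 hy, rfl⟩

theorem sum_gridNeighbors_comm (A : ℤ × ℤ → ℤ × ℤ → ℝ) :
    ∑ x ∈ boxFinset n, ∑ y ∈ gridNeighbors n x, A x y =
      ∑ x ∈ boxFinset n, ∑ y ∈ gridNeighbors n x, A y x := by
  refine Finset.sum_comm' fun x y => ?_
  simp only [mem_gridNeighbors, mem_boxFinset]
  exact ⟨fun h => ⟨h.2.symm, (Bgraph_adj.1 h.2).2.1⟩, fun h => ⟨(Bgraph_adj.1 h.1).2.1, h.1.symm⟩⟩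

theorem sum_gridNeighbors_sub (g : ℤ × ℤ → ℝ) :
    ∑ x ∈ boxFinset n, ∑ y ∈ gridNeighbors n x, (g x - g y) = 0 := by
  have h := sum_gridNeighbors_comm (n := n) fun x y => g x - g y
  have h' : ∑ x ∈ boxFinset n, ∑ y ∈ gridNeighbors n x, (g y - g x) =
      -∑ x ∈ boxFinset n, ∑ y ∈ gridNeighbors n x, (g x - g y) := by
    simp only [← Finset.sum_neg_distrib, neg_sub]
  linarith

theorem sum_gridNeighbors_sq (g : ℤ × ℤ → ℝ) :
    ∑ x ∈ boxFinset n, ∑ y ∈ gridNeighbors n x, (g y - g x) ^ 2 =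
      2 * ∑ x ∈ boxFinset n, g x * ∑ y ∈ gridNeighbors n x, (g x - g y) := by
  have h := sum_gridNeighbors_comm (n := n) fun x y => g x * (g x - g y)
  have h' : ∑ x ∈ boxFinset n, ∑ y ∈ gridNeighbors n x, (g y - g x) ^ 2 =
      ∑ x ∈ boxFinset n, ∑ y ∈ gridNeighbors n x, g x * (g x - g y) +
        ∑ x ∈ boxFinset n, ∑ y ∈ gridNeighbors n x, g y * (g y - g x) := by
    simp only [← Finset.sum_add_distrib]
    exact Finset.sum_congr rfl fun x _ => Finset.sum_congr rfl fun y _ => by ring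
  rw [h', ← h, ← two_mul]
  simp only [Finset.mul_sum]

theorem sum_mul_quadrupole {s : Finset (ℤ × ℤ)} (hs : ∀ j, t + dir j ∈ s) (g : ℤ × ℤ → ℝ) :
    ∑ x ∈ s, g x * quadrupole (x - t) = ∑ j, g (t + dir j) * (-1) ^ (j : ℕ) := by
  simp only [quadrupole, Finset.mul_sum]
  rw [Finset.sum_comm]
  refine Finset.sum_congr rfl fun j _ => ?_
  simp only [sub_eq_iff_eq_add', mul_ite, mul_zero, Finset.sum_ite_eq', hs, if_true]

theorem quadrupole_equation_at_root (ht : t ∈ Bbox n) (ht' : ∀ j, t + dir j ∈ Bbox n)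
    {g : ℤ × ℤ → ℝ} (hg : ∀ x ∈ Bbox n, x ≠ t →
      ∑ y ∈ gridNeighbors n x, (g x - g y) = quadrupole (x - t)) :
    ∑ y ∈ gridNeighbors n t, (g t - g y) = quadrupole (t - t) := by
  have h := sum_gridNeighbors_sub (n := n) g
  have h2 := sum_mul_quadrupole (t := t) (s := boxFinset n) (fun j => mem_boxFinset.2 (ht' j)) 1
  rw [← Finset.add_sum_erase _ _ (mem_boxFinset.2 ht)] at h h2
  have h3 : ∑ x ∈ (boxFinset n).erase t, ∑ y ∈ gridNeighbors n x, (g x - g y) =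
      ∑ x ∈ (boxFinset n).erase t, quadrupole (x - t) :=
    Finset.sum_congr rfl fun x hx => by
      rw [Finset.mem_erase, mem_boxFinset] at hx
      exact hg x hx.2 hx.1
  simp only [Pi.one_apply, one_mul, Fin.sum_univ_four] at h2
  norm_num at h2
  rw [h3] at h
  rw [sub_self]
  linarith

theorem energy_le (ht : t ∈ Bbox n) (ht' : ∀ j, t + dir j ∈ Bbox n)
    {g : ℤ × ℤ → ℝ} (h0 : g t = 0) (hg : ∀ x ∈ Bbox n,
      ∑ y ∈ gridNeighbors n x, (g x - g y) = quadrupole (x - t)) :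
    ∑ x ∈ boxFinset n, ∑ y ∈ gridNeighbors n x, (g y - g x) ^ 2 ≤ 16 := by
  have h1 := sum_gridNeighbors_sq (n := n) g
  have h3 : ∑ x ∈ boxFinset n, g x * ∑ y ∈ gridNeighbors n x, (g x - g y) =
      ∑ x ∈ boxFinset n, g x * quadrupole (x - t) :=
    Finset.sum_congr rfl fun x hx => by rw [hg x (mem_boxFinset.1 hx)]
  rw [h3, sum_mul_quadrupole fun j => mem_boxFinset.2 (ht' j)] at h1
  have h2 : ∑ y ∈ gridNeighbors n t, (g y - g t) ^ 2 ≤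
      ∑ x ∈ boxFinset n, ∑ y ∈ gridNeighbors n x, (g y - g x) ^ 2 :=
    Finset.single_le_sum (f := fun x => ∑ y ∈ gridNeighbors n x, (g y - g x) ^ 2)
      (fun x _ => Finset.sum_nonneg fun y _ => sq_nonneg _) (mem_boxFinset.2 ht)
  rw [sum_gridNeighbors_interior ht ht', h0] at h2
  simp only [Fin.sum_univ_four, sub_zero] at h1 h2
  norm_num at h1
  nlinarith [sq_nonneg (g (t + dir 0) - 2), sq_nonneg (g (t + dir 1) + 2),
    sq_nonneg (g (t + dir 2) - 2), sq_nonneg (g (t + dir 3) + 2)]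

theorem groundedLaplacian_apply {V : Type*} [DecidableEq V] (nb : V → Finset (Option V))
    (x y : V) : groundedLaplacian nb x y =
      (nb x).card * (if y = x then 1 else 0) - if some y ∈ nb x then 1 else 0 := by
  have h : ∀ o : Option V, optRow o y = if o = some y then 1 else 0 := by
    rintro (_ | z)
    · simp [optRow]
    · simp [optRow, Pi.single_apply, eq_comm]
  simp only [groundedLaplacian, Finset.sum_apply, Pi.sub_apply, Finset.sum_sub_distrib, h,
    Finset.sum_ite_eq', Pi.single_apply]
  simp

theorem groundedLaplacian_transpose :
    (groundedLaplacian (boxNeighbors n t)).transpose = groundedLaplacian (boxNeighbors n t) := by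
  ext x y
  rw [Matrix.transpose_apply, groundedLaplacian_apply, groundedLaplacian_apply]
  by_cases hxy : x = y
  · subst hxy; rfl
  · have : some x ∈ boxNeighbors n t y ↔ some y ∈ boxNeighbors n t x := by
      rw [mem_boxNeighbors, mem_boxNeighbors]
      exact (Bgraph n).adj_comm _ _
    simp [hxy, Ne.symm hxy, this]

theorem green_apply_comm {G : Matrix (NonRoot (Bbox n) t) (NonRoot (Bbox n) t) ℝ}
    (hG : groundedLaplacian (boxNeighbors n t) * G = 1) (x y : NonRoot (Bbox n) t) :
    G x y = G y x := by
  have h1 := congrArg Matrix.transpose hG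
  rw [Matrix.transpose_mul, groundedLaplacian_transpose, Matrix.transpose_one] at h1
  have h2 : G.transpose = G := by
    rw [← mul_one G.transpose, ← hG, ← mul_assoc, h1, one_mul]
  exact congrFun (congrFun h2.symm x) y

open Classical in
theorem exists_grounded_potential (ht : t ∈ Bbox n) {a : Fin 4 → NonRoot (Bbox n) t}
    (ha : ∀ j, (a j : ℤ × ℤ) = t + dir j) {G : Matrix (NonRoot (Bbox n) t) (NonRoot (Bbox n) t) ℝ}
    (hG : groundedLaplacian (boxNeighbors n t) * G = 1) :
    ∃ g : ℤ × ℤ → ℝ, g t = 0 ∧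
      (∀ x ∈ Bbox n, (∀ i, x + dir i ∈ Bbox n) → latticeLaplacian g x = quadrupole (x - t)) ∧
      (∀ K : Finset (ℤ × ℤ), (∀ x ∈ K, x ∈ Bbox n ∧ ∀ i, x + dir i ∈ Bbox n) →
        ∑ x ∈ K, ∑ i, (g (x + dir i) - g x) ^ 2 ≤ 16) ∧
      ∀ j, ∑ d : Fin 4, (-1) ^ (d : ℕ) * G (a d) (a j) = g (t + dir j) := by
  let γ : NonRoot (Bbox n) t → ℝ := fun x => ∑ d : Fin 4, (-1) ^ (d : ℕ) * G x (a d)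
  let g : ℤ × ℤ → ℝ := fun x => if h : x ∈ Bbox n ∧ x ≠ t then γ ⟨x, h⟩ else 0
  have h0 : g t = 0 := dif_neg fun h => h.2 rfl
  have hγ : ∀ x : NonRoot (Bbox n) t, g x = γ x := fun x => dif_pos x.2
  have ht' : ∀ j, t + dir j ∈ Bbox n := fun j => ha j ▸ (a j).2.1
  have hopt : ∀ o : Option (NonRoot (Bbox n) t), g (optVertex o) = o.elim 0 γ := by
    rintro (_ | x)
    · exact h0
    · exact hγ x
  have hrow : ∀ (x : NonRoot (Bbox n) t) (f : NonRoot (Bbox n) t → ℝ),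
      (groundedLaplacian (boxNeighbors n t)).mulVec f x =
        ∑ o ∈ boxNeighbors n t x, (f x - o.elim 0 f) := by
    intro x f
    rw [Matrix.mulVec, groundedLaplacian, sum_dotProduct]
    refine Finset.sum_congr rfl fun o _ => ?_
    rw [sub_dotProduct]
    rcases o with _ | z
    · simp [optRow]
    · simp [optRow]
  have hγeq : ∀ x, (groundedLaplacian (boxNeighbors n t)).mulVec γ x =
      quadrupole ((x : ℤ × ℤ) - t) := by
    intro x
    have e : γ = G.mulVec fun y => ∑ d : Fin 4, if y = a d then (-1 : ℝ) ^ (d : ℕ) else 0 := by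
      ext y
      simp only [γ, Matrix.mulVec, dotProduct, Finset.mul_sum]
      rw [Finset.sum_comm]
      simp [mul_comm]
    rw [e, Matrix.mulVec_mulVec, hG, Matrix.one_mulVec, quadrupole]
    refine Finset.sum_congr rfl fun d _ => if_congr ?_ rfl rfl
    rw [Subtype.ext_iff, ha, sub_eq_iff_eq_add']
  have hne : ∀ x ∈ Bbox n, x ≠ t →
      ∑ y ∈ gridNeighbors n x, (g x - g y) = quadrupole (x - t) := by
    intro x hx hxt
    have h1 := hγeq ⟨x, hx, hxt⟩
    rw [hrow] at h1
    simp only [← hγ, ← hopt] at h1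
    rwa [sum_boxNeighbors ⟨x, hx, hxt⟩ fun y => g x - g y] at h1
  have hall : ∀ x ∈ Bbox n, ∑ y ∈ gridNeighbors n x, (g x - g y) = quadrupole (x - t) := by
    intro x hx
    by_cases hxt : x = t
    · rw [hxt]
      exact quadrupole_equation_at_root ht ht' hne
    · exact hne x hx hxt
  refine ⟨g, h0, ?_, ?_, ?_⟩
  · intro x hx hx'
    rw [← hall x hx, sum_gridNeighbors_interior hx hx', latticeLaplacian]
  · intro K hK
    refine le_trans ?_ (energy_le ht ht' h0 hall)
    rw [Finset.sum_congr rfl fun x hx =>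
      (sum_gridNeighbors_interior (hK x hx).1 (hK x hx).2 fun y => (g y - g x) ^ 2).symm]
    exact Finset.sum_le_sum_of_subset_of_nonneg (fun x hx => mem_boxFinset.2 (hK x hx).1)
      fun x _ _ => Finset.sum_nonneg fun y _ => sq_nonneg _
  · intro j
    rw [← ha, hγ]
    simp only [γ, green_apply_comm hG (a j)]

end GroundedPotential

section TripodCounts

variable {n : ℕ} {t : ℤ × ℤ}

/-- The spanning trees of `B_n` having a tripod at `t` to `x`, `y` and `z`. -/
def tripodTreesAt (n : ℕ) (t x y z : ℤ × ℤ) : Set (Bgraph n).Subgraph :=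
  {T | T.verts = Bbox n ∧ T.coe.IsTree ∧ HasTripod n T t x y z}

theorem rootChildren_subset {p : NonRoot (Bbox n) t → Option (NonRoot (Bbox n) t)}
    (hp : ∀ v, p v ∈ boxNeighbors n t v) {a : Fin 4 → NonRoot (Bbox n) t}
    (ha : ∀ j, (a j : ℤ × ℤ) = t + dir j) : {x | p x = none} ⊆ Set.range a := fun x hx => by
  obtain ⟨j, rfl⟩ := exists_last_eq hp ha hx
  exact ⟨j, rfl⟩

theorem rootChildren_ncard {p : NonRoot (Bbox n) t → Option (NonRoot (Bbox n) t)}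
    (hp : ∀ v, p v ∈ boxNeighbors n t v) (hr : Rooted p) {a : Fin 4 → NonRoot (Bbox n) t}
    (ha : ∀ j, (a j : ℤ × ℤ) = t + dir j) {v : Fin 3 → NonRoot (Bbox n) t}
    (hv : DistinctLast p v) : {x | p x = none}.ncard = 3 ∨ {x | p x = none}.ncard = 4 := by
  have h1 : {x | p x = none}.ncard ≤ 4 := by
    refine (Set.ncard_le_ncard (rootChildren_subset hp ha)).trans ?_
    rw [← Set.image_univ]
    refine (Set.ncard_image_le).trans ?_
    simp [Set.ncard_univ]
  have h2 : 3 ≤ {x | p x = none}.ncard := by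
    have : ({last p (v 0), last p (v 1), last p (v 2)} : Set _) ⊆ {x | p x = none} := by
      rintro x (rfl | rfl | rfl) <;> exact parent_last hr _
    refine le_trans ?_ (Set.ncard_le_ncard this)
    rw [Set.ncard_eq_three.2 ⟨_, _, _, hv.1, hv.2.1, hv.2.2, rfl⟩]
  omega

theorem rootChildren_ncard_eq_four {p : NonRoot (Bbox n) t → Option (NonRoot (Bbox n) t)}
    (hp : ∀ v, p v ∈ boxNeighbors n t v) {a : Fin 4 → NonRoot (Bbox n) t}
    (ha : ∀ j, (a j : ℤ × ℤ) = t + dir j) :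
    {x | p x = none}.ncard = 4 ↔ ∀ j, p (a j) = none := by
  have hinj : Function.Injective a := fun i j hij => by
    have := congrArg Subtype.val hij
    rw [ha, ha] at this
    exact dir_injective (add_left_cancel this)
  have hcard : (Set.range a).ncard = 4 := by
    rw [← Set.image_univ, Set.ncard_image_of_injective _ hinj]
    simp [Set.ncard_univ]
  constructor
  · intro h j
    have := Set.eq_of_subset_of_ncard_le (rootChildren_subset hp ha) (by rw [h, hcard])
    have hj : a j ∈ {x | p x = none} := this.symm ▸ Set.mem_range_self j
    exact hj
  · intro h
    rw [← hcard]
    congr 1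
    refine (rootChildren_subset hp ha).antisymm ?_
    rintro _ ⟨j, rfl⟩
    exact h j

theorem parentTree_neighborSet_ncard (ht : t ∈ Bbox n)
    {p : NonRoot (Bbox n) t → Option (NonRoot (Bbox n) t)}
    (hp : ∀ v, p v ∈ boxNeighbors n t v) :
    ((parentTree (Bgraph n) p).neighborSet t).ncard = {x | p x = none}.ncard := by
  rw [parentTree_neighborSet ht fun x => mem_boxNeighbors.1 (hp x),
    Set.ncard_image_of_injective _ Subtype.val_injective]

open Classical in
theorem exists_tripod_potential {c : Fin 3 → ℤ} (h1 : 2 ≤ t.2) (h2 : t.2 < 2 * n)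
    (h3 : -n < t.1) (h4 : t.1 < n) (h5 : -n < c 0) (h6 : c 0 < c 1) (h7 : c 1 < c 2)
    (h8 : c 2 < n) :
    ∃ g : ℤ × ℤ → ℝ, g t = 0 ∧
      (∀ x ∈ Bbox n, (∀ i, x + dir i ∈ Bbox n) → latticeLaplacian g x = quadrupole (x - t)) ∧
      (∀ K : Finset (ℤ × ℤ), (∀ x ∈ K, x ∈ Bbox n ∧ ∀ i, x + dir i ∈ Bbox n) →
        ∑ x ∈ K, ∑ i, (g (x + dir i) - g x) ^ 2 ≤ 16) ∧
      ∃ m : Fin 4 → ℝ, (∀ d, 0 ≤ m d) ∧ 0 < ∑ d, m d ∧ ∃ N : ℕ → ℕ,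
        (∀ d, Nat.card {T : (Bgraph n).Subgraph //
          T ∈ tripodTreesAt n t (c 0, 0) (c 1, 0) (c 2, 0) ∧ (T.neighborSet t).ncard = d} = N d) ∧
        (Nat.card {T : (Bgraph n).Subgraph //
          T ∈ tripodTreesAt n t (c 0, 0) (c 1, 0) (c 2, 0)} : ℝ) = ∑ d, m d ∧
        (N 4 : ℝ) = ∑ j, m j * ((-1) ^ (j : ℕ) * g (t + dir j)) ∧
        (N 3 + N 4 : ℝ) = ∑ d, m d ∧ ∀ d < 3, N d = 0 := by
  have ht : t ∈ Bbox n := ⟨h3.le, h4.le, by omega, h2.le⟩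
  have hdir : ∀ j, t + dir j ∈ Bbox n ∧ t + dir j ≠ t := fun j => by
    refine ⟨?_, fun h => ?_⟩
    · fin_cases j <;> simp [dir, Bbox] <;> omega
    · have : dir j = 0 := by simpa using h
      exact (by decide : ∀ j, dir j ≠ 0) j this
  have hcv : ∀ i, -n < c i ∧ c i < n := fun i => by fin_cases i <;> simp <;> omega
  have hbot : ∀ i, (c i, (0 : ℤ)) ∈ Bbox n ∧ (c i, (0 : ℤ)) ≠ t := fun i => by
    refine ⟨⟨(hcv i).1.le, (hcv i).2.le, le_rfl, by simp only; omega⟩, fun h => ?_⟩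
    rw [← h] at h1
    simp at h1
  let a : Fin 4 → NonRoot (Bbox n) t := fun j => ⟨t + dir j, hdir j⟩
  let v : Fin 3 → NonRoot (Bbox n) t := fun i => ⟨(c i, 0), hbot i⟩
  have ha : ∀ j, (a j : ℤ × ℤ) = t + dir j := fun j => rfl
  have hv : ∀ i, (v i : ℤ × ℤ) = (c i, 0) := fun i => rfl
  obtain ⟨p₀, hp₀, hr₀, hl₀⟩ := exists_tripod_tree h1 h2.le h3 h4 h5 h6 h7 h8 hv
  have hG : groundedLaplacian (boxNeighbors n t) * (groundedLaplacian (boxNeighbors n t))⁻¹ = 1 :=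
    Matrix.mul_nonsing_inv _ (det_groundedLaplacian_ne_zero _ ⟨p₀, hp₀, hr₀⟩).isUnit
  obtain ⟨g, g0, gl, gE, gj⟩ := exists_grounded_potential ht ha hG
  obtain ⟨m, m0, mN, m4⟩ := tripod_weights ht (by omega) ha hv h6 h7 _ hG
  simp only [gj] at m4
  let S : ((NonRoot (Bbox n) t → Option (NonRoot (Bbox n) t)) → Prop) → ℕ := fun R =>
    Nat.card {p : NonRoot (Bbox n) t → Option (NonRoot (Bbox n) t) //
      (∀ v, p v ∈ boxNeighbors n t v) ∧ Rooted p ∧ R p}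
  have hS : ∀ (R : (NonRoot (Bbox n) t → Option (NonRoot (Bbox n) t)) → Prop)
      [DecidablePred fun p : NonRoot (Bbox n) t → Option (NonRoot (Bbox n) t) =>
        (∀ v, p v ∈ boxNeighbors n t v) ∧ Rooted p ∧ R p],
      (Finset.univ.filter fun p : NonRoot (Bbox n) t → Option (NonRoot (Bbox n) t) =>
        (∀ v, p v ∈ boxNeighbors n t v) ∧ Rooted p ∧ R p).card = S R := fun R _ => by
    rw [← Fintype.card_subtype, ← Nat.card_eq_fintype_card]
  rw [hS] at mN
  rw [hS fun p => DistinctLast p v ∧ ∀ j, p (a j) = none] at m4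
  have hcongr : ∀ R R' : (NonRoot (Bbox n) t → Option (NonRoot (Bbox n) t)) → Prop,
      (∀ p, (∀ v, p v ∈ boxNeighbors n t v) → Rooted p → (R p ↔ R' p)) → S R = S R' :=
    fun R R' h => Nat.card_congr (Equiv.subtypeEquivRight fun p =>
      and_congr_right fun hp => and_congr_right fun hr => h p hp hr)
  have hN : Nat.card {T : (Bgraph n).Subgraph //
      T ∈ tripodTreesAt n t (c 0, 0) (c 1, 0) (c 2, 0)} = S fun p => DistinctLast p v := by
    rw [← hS]
    refine Eq.trans ?_ (card_trees ht (fun T => HasTripod n T t (c 0, 0) (c 1, 0) (c 2, 0))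
      (fun p => DistinctLast p v) fun p hp hr => hasTripod_iff ht hp hr (v 0) (v 1) (v 2))
    exact Nat.card_congr (Equiv.subtypeEquivRight fun T => and_assoc.symm)
  let N : ℕ → ℕ := fun d => S fun p => DistinctLast p v ∧ {x | p x = none}.ncard = d
  have hNd' : ∀ d, N d = S fun p => DistinctLast p v ∧ {x | p x = none}.ncard = d :=
    fun d => rfl
  have hNd : ∀ d, Nat.card {T : (Bgraph n).Subgraph //
      T ∈ tripodTreesAt n t (c 0, 0) (c 1, 0) (c 2, 0) ∧ (T.neighborSet t).ncard = d} = N d := by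
    intro d
    rw [hNd', ← hS]
    refine Eq.trans ?_ (card_trees ht (fun T => HasTripod n T t (c 0, 0) (c 1, 0) (c 2, 0) ∧
      (T.neighborSet t).ncard = d) (fun p => DistinctLast p v ∧ {x | p x = none}.ncard = d)
      fun p hp hr => ?_)
    · exact Nat.card_congr (Equiv.subtypeEquivRight fun T =>
        (and_congr_left' and_assoc.symm).trans and_assoc)
    · rw [parentTree_neighborSet_ncard ht hp]
      exact and_congr_left' (hasTripod_iff ht hp hr (v 0) (v 1) (v 2))
  have hN4 : N 4 = S fun p => DistinctLast p v ∧ ∀ j, p (a j) = none :=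
    hcongr _ _ fun p hp hr => and_congr_right' (rootChildren_ncard_eq_four hp ha)
  have hN34 : N 3 + N 4 = S fun p => DistinctLast p v := by
    rw [hNd', hNd', ← hS, ← hS, ← hS, ← Finset.card_union_of_disjoint, ← Finset.filter_or]
    · refine congrArg Finset.card (Finset.filter_congr fun p _ => ?_)
      constructor
      · rintro (⟨hp, hr, h, -⟩ | ⟨hp, hr, h, -⟩) <;> exact ⟨hp, hr, h⟩
      · rintro ⟨hp, hr, h⟩
        rcases rootChildren_ncard hp hr ha h with h' | h'
        · exact Or.inl ⟨hp, hr, h, h'⟩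
        · exact Or.inr ⟨hp, hr, h, h'⟩
    · rw [Finset.disjoint_filter]
      rintro p - ⟨-, -, -, h⟩ ⟨-, -, -, h'⟩
      omega
  refine ⟨g, g0, gl, gE, m, m0, ?_, N, hNd, hN ▸ mN, hN4 ▸ m4, ?_, ?_⟩
  · rw [← mN, ← hS, Nat.cast_pos, Finset.card_pos]
    exact ⟨p₀, Finset.mem_filter.2 ⟨Finset.mem_univ _, hp₀, hr₀, hl₀⟩⟩
  · rw [← mN, ← Nat.cast_add, hN34]
  · intro d hd
    rw [hNd', ← hS, Finset.card_eq_zero, Finset.filter_eq_empty_iff]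
    rintro p - ⟨hp, hr, h, h'⟩
    rcases rootChildren_ncard hp hr ha h with h'' | h'' <;> omega

end TripodCounts

section ScalingLimit

open Filter Topology

theorem tendsto_sqrt_cast : Tendsto (fun n : ℕ => (Nat.sqrt n : ℝ)) atTop atTop := by
  refine tendsto_natCast_atTop_atTop.comp (tendsto_atTop.2 fun b => ?_)
  filter_upwards [eventually_ge_atTop (b * b)] with n hn
  exact Nat.le_sqrt.2 hn

theorem eventually_lt_floor_of_pos {x : ℝ} (hx : 0 < x) (R : ℤ) :
    ∀ᶠ n : ℕ in atTop, R < ⌊(Nat.sqrt n : ℝ) * x⌋ := by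
  filter_upwards [(tendsto_sqrt_cast.atTop_mul_const hx).eventually_ge_atTop (R + 1 : ℝ)] with n hn
  rw [Int.lt_iff_add_one_le, Int.le_floor]
  exact_mod_cast hn

theorem eventually_floor_lt_floor {x y : ℝ} (h : x < y) :
    ∀ᶠ n : ℕ in atTop, ⌊(Nat.sqrt n : ℝ) * x⌋ < ⌊(Nat.sqrt n : ℝ) * y⌋ := by
  filter_upwards [(tendsto_sqrt_cast.atTop_mul_const (sub_pos.2 h)).eventually_ge_atTop 1]
    with n hn
  rw [Int.lt_iff_add_one_le, ← Int.floor_add_one]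
  exact Int.floor_le_floor (by linarith)

theorem eventually_abs_floor_lt (x : ℝ) (R : ℤ) :
    ∀ᶠ n : ℕ in atTop, |⌊(Nat.sqrt n : ℝ) * x⌋| + R < n := by
  filter_upwards [tendsto_sqrt_cast.eventually_ge_atTop (|x| + |(R : ℝ)| + 2)] with n hn
  have hm : (Nat.sqrt n : ℝ) * Nat.sqrt n ≤ n := by exact_mod_cast Nat.sqrt_le n
  set m : ℝ := (Nat.sqrt n : ℝ)
  have h1 : |(⌊m * x⌋ : ℝ)| ≤ m * |x| + 1 := by
    have hm0 : 0 ≤ m := by positivity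
    rw [← abs_of_nonneg hm0, ← abs_mul, abs_of_nonneg hm0]
    have h2 := Int.floor_le (m * x)
    have h3 := Int.sub_one_lt_floor (m * x)
    rw [abs_le]
    constructor
    · linarith [neg_abs_le (m * x)]
    · linarith [le_abs_self (m * x)]
  have h4 := le_abs_self (R : ℝ)
  have h5 := abs_nonneg x
  have h6 := abs_nonneg (R : ℝ)
  have : |(⌊m * x⌋ : ℝ)| + R < n := by nlinarith
  exact_mod_cast this

theorem eventually_interior (u : ℂ) (hu : 0 < u.im) (x : ℤ × ℤ) :
    ∀ᶠ n : ℕ in atTop, tripodPt u n + x ∈ Bbox n ∧ ∀ i, tripodPt u n + x + dir i ∈ Bbox n := by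
  filter_upwards [eventually_abs_floor_lt u.re (|x.1| + 1), eventually_abs_floor_lt u.im (|x.2| + 1),
    eventually_lt_floor_of_pos hu (|x.2| + 1)] with n h1 h2 h3
  simp only [tripodPt]
  generalize ⌊(Nat.sqrt n : ℝ) * u.re⌋ = a at *
  generalize ⌊(Nat.sqrt n : ℝ) * u.im⌋ = b at *
  have := abs_lt.1 (lt_sub_iff_add_lt.2 h1)
  have := abs_lt.1 (lt_sub_iff_add_lt.2 h2)
  have := neg_abs_le x.1
  have := le_abs_self x.1
  have := neg_abs_le x.2
  have := le_abs_self x.2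
  refine ⟨?_, fun i => ?_⟩
  · refine ⟨?_, ?_, ?_, ?_⟩ <;> simp only [Prod.fst_add, Prod.snd_add] <;> omega
  · fin_cases i <;> refine ⟨?_, ?_, ?_, ?_⟩ <;> simp [dir] <;> omega

theorem hasTripod_swap_left {n : ℕ} {T : (Bgraph n).Subgraph} {a b c d : ℤ × ℤ}
    (h : HasTripod n T a b c d) : HasTripod n T a c b d := by
  obtain ⟨p₁, p₂, p₃, h₁, h₂, h₃, h₁₂, h₁₃, h₂₃⟩ := h
  exact ⟨p₂, p₁, p₃, h₂, h₁, h₃, fun x hx hx' => h₁₂ x hx' hx, h₂₃, h₁₃⟩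

theorem hasTripod_swap_right {n : ℕ} {T : (Bgraph n).Subgraph} {a b c d : ℤ × ℤ}
    (h : HasTripod n T a b c d) : HasTripod n T a b d c := by
  obtain ⟨p₁, p₂, p₃, h₁, h₂, h₃, h₁₂, h₁₃, h₂₃⟩ := h
  exact ⟨p₁, p₃, p₂, h₁, h₃, h₂, h₁₃, h₁₂, fun x hx hx' => h₂₃ x hx' hx⟩

theorem tripodTrees_swap_left (z₁ z₂ z₃ : ℝ) (u : ℂ) :
    TripodTrees z₁ z₂ z₃ u = TripodTrees z₂ z₁ z₃ u := by
  ext n T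
  exact and_congr_right' (and_congr_right' ⟨hasTripod_swap_left, hasTripod_swap_left⟩)

theorem tripodTrees_swap_right (z₁ z₂ z₃ : ℝ) (u : ℂ) :
    TripodTrees z₁ z₂ z₃ u = TripodTrees z₁ z₃ z₂ u := by
  ext n T
  exact and_congr_right' (and_congr_right' ⟨hasTripod_swap_right, hasTripod_swap_right⟩)

theorem abs_weighted_average_sub_le {ι : Type*} [Fintype ι] {m q : ι → ℝ} {l : ℝ}
    (hm : ∀ i, 0 ≤ m i) (hpos : 0 < ∑ i, m i) :
    |(∑ i, m i * q i) / ∑ i, m i - l| ≤ ∑ i, |q i - l| := by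
  have e : (∑ i, m i * q i) / ∑ i, m i - l = (∑ i, m i * (q i - l)) / ∑ i, m i := by
    rw [div_sub' hpos.ne', Finset.sum_mul, ← Finset.sum_sub_distrib]
    simp only [mul_sub]
  rw [e, abs_div, abs_of_pos hpos, div_le_iff₀ hpos]
  refine (Finset.abs_sum_le_sum_abs _ _).trans ?_
  rw [Finset.sum_mul]
  refine Finset.sum_le_sum fun i _ => ?_
  rw [abs_mul, abs_of_nonneg (hm i), mul_comm]
  exact mul_le_mul_of_nonneg_left (Finset.single_le_sum (fun j _ => hm j) (Finset.mem_univ i))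
    (abs_nonneg _)

theorem tripod_degree_statistics_of_lt {z₁ z₂ z₃ : ℝ} (h₁₂ : z₁ < z₂) (h₂₃ : z₂ < z₃) (u : ℂ)
    (hu : 0 < u.im) :
    Tendsto
      (fun n : ℕ =>
        (Nat.card {T : (Bgraph n).Subgraph // T ∈ TripodTrees z₁ z₂ z₃ u n ∧
            (T.neighborSet (tripodPt u n)).ncard = 4} : ℝ) /
          (Nat.card {T : (Bgraph n).Subgraph // T ∈ TripodTrees z₁ z₂ z₃ u n} : ℝ))
      atTop (𝓝 (4 / Real.pi - 1)) ∧
    Tendsto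
      (fun n : ℕ =>
        (∑ d ∈ Finset.range 5, (d : ℝ) *
            (Nat.card {T : (Bgraph n).Subgraph // T ∈ TripodTrees z₁ z₂ z₃ u n ∧
              (T.neighborSet (tripodPt u n)).ncard = d} : ℝ)) /
          (Nat.card {T : (Bgraph n).Subgraph // T ∈ TripodTrees z₁ z₂ z₃ u n} : ℝ))
      atTop (𝓝 (2 + 4 / Real.pi)) := by
  have hex : ∀ᶠ n : ℕ in atTop, ∃ g : ℤ × ℤ → ℝ, g (tripodPt u n) = 0 ∧
      (∀ x ∈ Bbox n, (∀ i, x + dir i ∈ Bbox n) →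
        latticeLaplacian g x = quadrupole (x - tripodPt u n)) ∧
      (∀ K : Finset (ℤ × ℤ), (∀ x ∈ K, x ∈ Bbox n ∧ ∀ i, x + dir i ∈ Bbox n) →
        ∑ x ∈ K, ∑ i, (g (x + dir i) - g x) ^ 2 ≤ 16) ∧
      ∃ m : Fin 4 → ℝ, (∀ d, 0 ≤ m d) ∧ 0 < ∑ d, m d ∧ ∃ N : ℕ → ℕ,
        (∀ d, Nat.card {T : (Bgraph n).Subgraph // T ∈ TripodTrees z₁ z₂ z₃ u n ∧
          (T.neighborSet (tripodPt u n)).ncard = d} = N d) ∧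
        (Nat.card {T : (Bgraph n).Subgraph // T ∈ TripodTrees z₁ z₂ z₃ u n} : ℝ) = ∑ d, m d ∧
        (N 4 : ℝ) = ∑ j, m j * ((-1) ^ (j : ℕ) * g (tripodPt u n + dir j)) ∧
        (N 3 + N 4 : ℝ) = ∑ d, m d ∧ ∀ d < 3, N d = 0 := by
    filter_upwards [eventually_lt_floor_of_pos hu 1, eventually_abs_floor_lt u.im 0,
      eventually_abs_floor_lt u.re 0, eventually_abs_floor_lt z₁ 0, eventually_abs_floor_lt z₃ 0,
      eventually_floor_lt_floor h₁₂, eventually_floor_lt_floor h₂₃] with n h1 h2 h3 h4 h5 h6 h7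
    rw [add_zero, abs_lt] at h2 h3 h4 h5
    exact exists_tripod_potential (n := n) (t := tripodPt u n)
      (c := ![⌊(Nat.sqrt n : ℝ) * z₁⌋, ⌊(Nat.sqrt n : ℝ) * z₂⌋, ⌊(Nat.sqrt n : ℝ) * z₃⌋])
      h1 (by simp only [tripodPt]; omega) h3.1 h3.2 h4.1 h6 h7 h5.2
  obtain ⟨g, hg⟩ := hex.choice
  have hF := tendsto_of_energy_le (F := fun n x => g n (tripodPt u n + x)) (C := 16)
    (hg.mono fun n h => by simpa using h.1)
    (fun x => by
      filter_upwards [hg, eventually_interior u hu x] with n h h'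
      have := h.2.1 _ h'.1 h'.2
      rw [add_sub_cancel_left] at this
      simpa only [latticeLaplacian, add_assoc] using this)
    (fun K => by
      filter_upwards [hg, (Filter.eventually_all_finset K).2 fun x _ => eventually_interior u hu x]
        with n h h'
      have := h.2.2.1 (K.map (addLeftEmbedding (tripodPt u n))) (by
        intro x hx
        obtain ⟨y, hy, rfl⟩ := Finset.mem_map.1 hx
        exact h' y hy)
      rw [Finset.sum_map] at this
      simpa only [addLeftEmbedding_apply, add_assoc] using this)
  have hfirst : Tendsto
      (fun n : ℕ =>
        (Nat.card {T : (Bgraph n).Subgraph // T ∈ TripodTrees z₁ z₂ z₃ u n ∧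
            (T.neighborSet (tripodPt u n)).ncard = 4} : ℝ) /
          (Nat.card {T : (Bgraph n).Subgraph // T ∈ TripodTrees z₁ z₂ z₃ u n} : ℝ))
      atTop (𝓝 (4 / Real.pi - 1)) := by
    rw [tendsto_iff_dist_tendsto_zero]
    have hlim : Tendsto (fun n => ∑ j : Fin 4, |(-1) ^ (j : ℕ) * g n (tripodPt u n + dir j) -
        (4 / Real.pi - 1)|) atTop (𝓝 0) := by
      have : ∀ j : Fin 4, Tendsto (fun n => |(-1) ^ (j : ℕ) * g n (tripodPt u n + dir j) -
          (4 / Real.pi - 1)|) atTop (𝓝 0) := fun j => by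
        have := (((hF (dir j)).const_mul ((-1 : ℝ) ^ (j : ℕ))).sub_const (4 / Real.pi - 1)).abs
        rwa [quadrupolePotential_dir, sub_self, abs_zero] at this
      simpa using tendsto_finsetSum Finset.univ fun j _ => this j
    refine squeeze_zero' (Eventually.of_forall fun n => dist_nonneg) ?_ hlim
    filter_upwards [hg] with n h
    obtain ⟨-, -, -, m, hm, hpos, N, hN, hcard, h4, -, -⟩ := h
    have e1 := hN 4
    rw [← e1] at h4
    rw [Real.dist_eq]
    refine le_trans (le_of_eq ?_) (abs_weighted_average_sub_le hm hpos)
    rw [← hcard, ← h4]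
  refine ⟨hfirst, ?_⟩
  have := hfirst.const_add 3
  rw [show 3 + (4 / Real.pi - 1) = 2 + 4 / Real.pi by ring] at this
  refine this.congr' ?_
  filter_upwards [hg] with n h
  obtain ⟨-, -, -, m, -, hpos, N, hN, hcard, -, h34, hlt⟩ := h
  simp only [hN, hcard, Finset.sum_range_succ, Finset.sum_range_zero, hlt 0 (by norm_num),
    hlt 1 (by norm_num), hlt 2 (by norm_num)]
  rw [← h34] at hpos ⊢
  field_simp
  push_cast
  ring

end ScalingLimit

theorem tripod_degree_statistics (z₁ z₂ z₃ : ℝ)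
    (hz : z₁ ≠ z₂ ∧ z₁ ≠ z₃ ∧ z₂ ≠ z₃) (u : ℂ) (hu : 0 < u.im) :
    Filter.Tendsto
      (fun n : ℕ =>
        (Nat.card {T : (Bgraph n).Subgraph // T ∈ TripodTrees z₁ z₂ z₃ u n ∧
            (T.neighborSet (tripodPt u n)).ncard = 4} : ℝ) /
          (Nat.card {T : (Bgraph n).Subgraph // T ∈ TripodTrees z₁ z₂ z₃ u n} : ℝ))
      Filter.atTop (nhds (4 / Real.pi - 1)) ∧
    Filter.Tendsto
      (fun n : ℕ =>
        (∑ d ∈ Finset.range 5, (d : ℝ) *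
            (Nat.card {T : (Bgraph n).Subgraph // T ∈ TripodTrees z₁ z₂ z₃ u n ∧
              (T.neighborSet (tripodPt u n)).ncard = d} : ℝ)) /
          (Nat.card {T : (Bgraph n).Subgraph // T ∈ TripodTrees z₁ z₂ z₃ u n} : ℝ))
      Filter.atTop (nhds (2 + 4 / Real.pi)) := by
  obtain ⟨h₁₂, h₁₃, h₂₃⟩ := hz
  rcases lt_or_gt_of_ne h₁₂ with h | h <;> rcases lt_or_gt_of_ne h₂₃ with h' | h'
  · exact tripod_degree_statistics_of_lt h h' u hu
  · rcases lt_or_gt_of_ne h₁₃ with h'' | h''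
    · rw [tripodTrees_swap_right]
      exact tripod_degree_statistics_of_lt h'' h' u hu
    · rw [tripodTrees_swap_right, tripodTrees_swap_left]
      exact tripod_degree_statistics_of_lt h'' h u hu
  · rcases lt_or_gt_of_ne h₁₃ with h'' | h''
    · rw [tripodTrees_swap_left]
      exact tripod_degree_statistics_of_lt h h'' u hu
    · rw [tripodTrees_swap_left, tripodTrees_swap_right]
      exact tripod_degree_statistics_of_lt h' h'' u hu
  · rw [tripodTrees_swap_left, tripodTrees_swap_right, tripodTrees_swap_left]
    exact tripod_degree_statistics_of_lt h' h u hu
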